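/- Let I′ = a₀I₀ ⊕ … ⊕ aₙIₙ and I = c₀I₀ ⊕ … ⊕ cₙIₙ be preinjective Kronecker representations. Then there exist α, β ∈ ℕ with [I] ∈ {[βI₀]} * {[I′]} * {[αP₀]} (i.e., I′ is a subfactor of I) if and only if there exist non-negative integers u₀,…,uₙ satisfying u₀ ≥ a₀; Σ_{i=t}^{n} i·uᵢ ≤ Σ_{i=t}^{n} i·aᵢ for 2 ≤ t ≤ n; Σ_{i=1}^{n} i·uᵢ = Σ_{i=1}^{n} i·aᵢ; Σ_{i=0}^{n}(i+1)uᵢ = Σ_{i=0}^{n}(i+1)cᵢ; and Σ_{i=t}^{n}(i+1)uᵢ ≤ Σ_{i=t}^{n}(i+1)cᵢ for 1 ≤ t ≤ n. -/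

import Mathlib

open Matrix Finset

/-- A finite-dimensional representation of the Kronecker quiver over `k`:
two vector spaces `k^{d1}`, `k^{d2}` and two linear maps `k^{d2} → k^{d1}`
given by the matrices `A` and `B`. -/
structure KRep (k : Type) [Field k] where
  d1 : ℕ
  d2 : ℕ
  A : Matrix (Fin d1) (Fin d2) k
  B : Matrix (Fin d1) (Fin d2) k

/-- A morphism of Kronecker representations `M → N`. -/
structure KHom {k : Type} [Field k] (M N : KRep k) where
  f1 : Matrix (Fin N.d1) (Fin M.d1) k
  f2 : Matrix (Fin N.d2) (Fin M.d2) k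
  comm_a : f1 * M.A = N.A * f2
  comm_b : f1 * M.B = N.B * f2

variable {k : Type} [Field k]

/-- A monomorphism: both components injective. -/
def KHom.Mono {M N : KRep k} (f : KHom M N) : Prop :=
  Function.Injective f.f1.mulVecLin ∧ Function.Injective f.f2.mulVecLin

/-- An epimorphism: both components surjective. -/
def KHom.Epi {M N : KRep k} (f : KHom M N) : Prop :=
  Function.Surjective f.f1.mulVecLin ∧ Function.Surjective f.f2.mulVecLin

/-- Isomorphism of Kronecker representations. -/
def KIso (M N : KRep k) : Prop :=
  ∃ f : KHom M N, Function.Bijective f.f1.mulVecLin ∧ Function.Bijective f.f2.mulVecLin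

/-- `SES N Y M` : there is a short exact sequence `0 → N → Y → M → 0`. -/
def SES (N Y M : KRep k) : Prop :=
  ∃ (f : KHom N Y) (g : KHom Y M), f.Mono ∧ g.Epi ∧
    LinearMap.range f.f1.mulVecLin = LinearMap.ker g.f1.mulVecLin ∧
    LinearMap.range f.f2.mulVecLin = LinearMap.ker g.f2.mulVecLin

/-- The zero representation. -/
def KRep.zero : KRep k := ⟨0, 0, 0, 0⟩

/-- Direct sum of two Kronecker representations (block diagonal matrices). -/
def KRep.dsum (M N : KRep k) : KRep k where
  d1 := M.d1 + N.d1
  d2 := M.d2 + N.d2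
  A := Matrix.reindex finSumFinEquiv finSumFinEquiv (Matrix.fromBlocks M.A 0 0 N.A)
  B := Matrix.reindex finSumFinEquiv finSumFinEquiv (Matrix.fromBlocks M.B 0 0 N.B)

/-- Direct sum of a list of Kronecker representations. -/
def KRep.dsumList (l : List (KRep k)) : KRep k := l.foldr KRep.dsum KRep.zero

/-- The preprojective indecomposable `P n`, with maps `k^n → k^{n+1}`
given by the matrices `(I_n ; 0)` and `(0 ; I_n)`. -/
def KRep.P (k : Type) [Field k] (n : ℕ) : KRep k where
  d1 := n + 1
  d2 := n
  A := Matrix.of fun i j => if (i : ℕ) = (j : ℕ) then 1 else 0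
  B := Matrix.of fun i j => if (i : ℕ) = (j : ℕ) + 1 then 1 else 0

/-- The preinjective indecomposable `I n`, with maps `k^{n+1} → k^n`
given by the matrices `(I_n  0)` and `(0  I_n)`. -/
def KRep.Inj (k : Type) [Field k] (n : ℕ) : KRep k where
  d1 := n
  d2 := n + 1
  A := Matrix.of fun i j => if (i : ℕ) = (j : ℕ) then 1 else 0
  B := Matrix.of fun i j => if (i : ℕ) + 1 = (j : ℕ) then 1 else 0

/-- `M` is indecomposable: nonzero, and any decomposition as a direct sum
of two subrepresentations has a zero summand. -/
def KRep.Indecomposable (M : KRep k) : Prop :=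
  0 < M.d1 + M.d2 ∧
    ∀ N₁ N₂ : KRep k, KIso M (N₁.dsum N₂) → N₁.d1 + N₁.d2 = 0 ∨ N₂.d1 + N₂.d2 = 0

/-- The preinjective representation `a 0 · I₀ ⊕ a 1 · I₁ ⊕ ⋯ ⊕ a n · Iₙ`. -/
def KRep.multi (k : Type) [Field k] (a : ℕ → ℕ) (n : ℕ) : KRep k :=
  KRep.dsumList (((List.range (n + 1)).flatMap fun i => List.replicate (a i) (KRep.Inj k i)))

/-- `M'` is a subfactor of `M`: there is a linking module `L` with
`M' ↪ L ↞ M`. -/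
def IsSubfactor (M' M : KRep k) : Prop :=
  ∃ L : KRep k, (∃ f : KHom M' L, f.Mono) ∧ (∃ g : KHom M L, g.Epi)

/-! ### Chains of a linear relation -/

section Chains

variable {X Y Z : Type*} [AddCommGroup X] [Module k X] [AddCommGroup Y] [Module k Y]
  [AddCommGroup Z] [Module k Z]

/-- Sequences of length `t` whose consecutive terms are related by `R`. -/
def chains (R : Submodule k (Z × Z)) (t : ℕ) : Submodule k (Fin t → Z) where
  carrier := {z | ∀ i (h : i + 1 < t), (z ⟨i, by omega⟩, z ⟨i + 1, h⟩) ∈ R}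
  add_mem' hx hy i h := R.add_mem (hx i h) (hy i h)
  zero_mem' _ _ := R.zero_mem
  smul_mem' r _ hx i h := R.smul_mem r (hx i h)

theorem finrank_le_finrank_range_add [FiniteDimensional k X] [FiniteDimensional k Z]
    (Φ : X →ₗ[k] Y) (Θ : X →ₗ[k] Z) (P : Submodule k Z) (hmem : ∀ v, Φ v = 0 → Θ v ∈ P)
    (hinj : ∀ v, Φ v = 0 → Θ v = 0 → v = 0) :
    Module.finrank k X ≤ Module.finrank k (LinearMap.range Φ) + Module.finrank k P := by
  let Θ' : LinearMap.ker Φ →ₗ[k] P :=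
    (Θ ∘ₗ (LinearMap.ker Φ).subtype).codRestrict P fun p => hmem p.1 p.2
  have hΘ' : Function.Injective Θ' := by
    refine (injective_iff_map_eq_zero Θ').2 fun p h0 => ?_
    exact Subtype.ext (hinj p.1 p.2 (congrArg Subtype.val h0))
  rw [← LinearMap.finrank_range_add_finrank_ker Φ]
  exact Nat.add_le_add_left (LinearMap.finrank_le_finrank_of_injective hΘ') _

/-- Let `G` be a space of chains of length `r + 2`. Truncating the elements of `G` and shifting
chains of length `t` gives a space of chains of length `r + 1`; two elements that cancel glue to a
chain of length `t + 1`. -/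
theorem exists_chains_of_truncate [FiniteDimensional k Z] (R : Submodule k (Z × Z))
    (F : Submodule k Z) {s r t : ℕ} (ht : t = s + 1 + r + 1)
    (hF : ∀ z ∈ chains R t, ∀ i, z i ∈ F)
    (G : Submodule k (Fin (r + 2) → Z)) (hG : G ≤ chains R (r + 2))
    (hGF : ∀ z ∈ G, ∀ i, z i ∈ F) :
    ∃ G' : Submodule k (Fin (r + 1) → Z), G' ≤ chains R (r + 1) ∧ (∀ z ∈ G', ∀ i, z i ∈ F) ∧
      Module.finrank k G + Module.finrank k (chains R t) ≤
        Module.finrank k G' + Module.finrank k (chains R (t + 1)) := by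
  let T : (Fin (r + 2) → Z) →ₗ[k] (Fin (r + 1) → Z) := LinearMap.funLeft k Z Fin.castSucc
  let S : (Fin t → Z) →ₗ[k] (Fin (r + 1) → Z) :=
    LinearMap.funLeft k Z fun i => ⟨i + (s + 1), by omega⟩
  let Φ : (G × chains R t) →ₗ[k] (Fin (r + 1) → Z) :=
    (T ∘ₗ G.subtype).coprod (S ∘ₗ (chains R t).subtype)
  have hΦ : ∀ g ψ (i : Fin (r + 1)),
      Φ (g, ψ) i = g.1 i.castSucc + ψ.1 ⟨i + (s + 1), by omega⟩ := fun _ _ _ => rfl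
  refine ⟨LinearMap.range Φ, ?_, ?_, ?_⟩
  · rintro _ ⟨⟨g, ψ⟩, rfl⟩ i h
    have h1 := hG g.2 i (by omega)
    have h2 := ψ.2 (i + (s + 1)) (by omega)
    have h3 := R.add_mem h1 h2
    have e : i + 1 + (s + 1) = i + (s + 1) + 1 := by omega
    rw [hΦ, hΦ]
    simp only [e]
    exact h3
  · rintro _ ⟨⟨g, ψ⟩, rfl⟩ i
    rw [hΦ]
    exact F.add_mem (hGF _ g.2 _) (hF _ ψ.2 _)
  · let Θ : (G × chains R t) →ₗ[k] (Fin (t + 1) → Z) :=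
      { toFun := fun p => Fin.snoc (α := fun _ => Z) p.2.1 (-(p.1.1 (Fin.last _)))
        map_add' := by
          intro p q
          ext i
          refine Fin.lastCases ?_ (fun i => ?_) i
          · simp [add_comm]
          · simp
        map_smul' := by
          intro c p
          ext i
          refine Fin.lastCases ?_ (fun i => ?_) i
          · simp
          · simp }
    have hΘ1 : ∀ p i, Θ p (Fin.castSucc i) = p.2.1 i := fun p i => by simp [Θ]
    have hΘ2 : ∀ p, Θ p (Fin.last _) = -(p.1.1 (Fin.last _)) := fun p => by simp [Θ]
    have hker : ∀ p, Φ p = 0 → ∀ i : Fin (r + 1),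
        p.2.1 ⟨i + (s + 1), by omega⟩ = -p.1.1 i.castSucc := by
      rintro ⟨g, ψ⟩ hp i
      have := congrFun hp i
      rw [hΦ] at this
      exact (neg_eq_of_add_eq_zero_right this).symm
    have hmem : ∀ p, Φ p = 0 → Θ p ∈ chains R (t + 1) := by
      intro p hp i h
      by_cases hi : i + 1 < t
      · have := p.2.2 i hi
        rw [← hΘ1, ← hΘ1] at this
        exact this
      · obtain rfl : i + 1 = t := by omega
        have e1 : Θ p ⟨i + 1, h⟩ = -(p.1.1 (Fin.last _)) := hΘ2 p
        have e2 : Θ p ⟨i, by omega⟩ = -p.1.1 ⟨r, by omega⟩ := by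
          have h1 := hΘ1 p ⟨i, by omega⟩
          have h2 := hker p hp ⟨r, by omega⟩
          exact h1.trans (Eq.trans (congrArg p.2.1 (Fin.ext (by simp; omega))) h2)
        rw [e1, e2]
        have := R.neg_mem (hG p.1.2 r (by omega))
        exact this
    have hinj : ∀ p, Φ p = 0 → Θ p = 0 → p = 0 := by
      intro p hp h0
      have hψ : ∀ i, p.2.1 i = 0 := fun i => by rw [← hΘ1, h0]; rfl
      have hg : ∀ i, p.1.1 i = 0 := by
        intro i
        refine Fin.lastCases ?_ (fun i => ?_) i
        · have := hΘ2 p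
          rw [h0] at this
          simpa using this.symm
        · have := hker p hp i
          rw [hψ] at this
          simpa using this.symm
      exact Prod.ext (Subtype.ext (funext hg)) (Subtype.ext (funext hψ))
    rw [← Module.finrank_prod]
    exact finrank_le_finrank_range_add Φ Θ _ hmem hinj

theorem exists_chains_of_shift [FiniteDimensional k Z] (R : Submodule k (Z × Z))
    (F : Submodule k Z) {t : ℕ} (hF : ∀ z ∈ chains R t, ∀ i, z i ∈ F) (s : ℕ) :
    ∀ r, t = s + r + 1 → ∃ G : Submodule k (Fin (r + 1) → Z), G ≤ chains R (r + 1) ∧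
      (∀ z ∈ G, ∀ i, z i ∈ F) ∧ (s + 1) * Module.finrank k (chains R t) ≤
        Module.finrank k G + s * Module.finrank k (chains R (t + 1)) := by
  induction s with
  | zero =>
    intro r ht
    obtain rfl : t = r + 1 := by omega
    exact ⟨chains R (r + 1), le_rfl, hF, by simp⟩
  | succ s ih =>
    intro r ht
    obtain ⟨G, hG, hGF, h⟩ := ih (r + 1) (by omega)
    obtain ⟨G', hG', hGF', h'⟩ := exists_chains_of_truncate R F (s := s) (r := r) ht hF G hG hGF
    exact ⟨G', hG', hGF', by nlinarith⟩

theorem mul_finrank_chains_le [FiniteDimensional k Z] (R : Submodule k (Z × Z))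
    (F : Submodule k Z) (t : ℕ) (hF : ∀ z ∈ chains R (t + 1), ∀ i, z i ∈ F) :
    (t + 1) * Module.finrank k (chains R (t + 1)) ≤
      Module.finrank k F + t * Module.finrank k (chains R (t + 2)) := by
  obtain ⟨G, -, hGF, h⟩ := exists_chains_of_shift R F hF t 0 (by omega)
  let e : G →ₗ[k] F := ((LinearMap.proj (0 : Fin 1)) ∘ₗ G.subtype).codRestrict F
    fun g => hGF _ g.2 0
  have he : Function.Injective e := by
    intro x y hxy
    ext i
    obtain rfl : i = 0 := Fin.fin_one_eq_zero i
    exact congrArg Subtype.val hxy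
  exact h.trans (Nat.add_le_add_right (LinearMap.finrank_le_finrank_of_injective he) _)

theorem two_mul_finrank_chains_le [FiniteDimensional k Z] (R : Submodule k (Z × Z)) (t : ℕ) :
    2 * Module.finrank k (chains R (t + 2)) ≤
      Module.finrank k (chains R (t + 1)) + Module.finrank k (chains R (t + 3)) := by
  obtain ⟨G, hG, -, h⟩ := exists_chains_of_shift R ⊤ (t := t + 2) (fun _ _ _ => trivial) 1 t
    (by omega)
  rw [one_mul] at h
  exact h.trans (Nat.add_le_add_right (Submodule.finrank_mono hG) _)

/-- Pairs `(x, x')` with `β x = α x'`. -/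
def relDom (α β : X →ₗ[k] Y) : Submodule k (X × X) :=
  LinearMap.ker (β ∘ₗ LinearMap.fst k X X - α ∘ₗ LinearMap.snd k X X)

/-- Pairs `(α x, β x)`. -/
def relCod (α β : X →ₗ[k] Y) : Submodule k (Y × Y) := LinearMap.range (α.prod β)

theorem mem_relDom {α β : X →ₗ[k] Y} {p : X × X} : p ∈ relDom α β ↔ β p.1 = α p.2 := by
  simp [relDom, sub_eq_zero]

theorem mem_relCod {α β : X →ₗ[k] Y} {p : Y × Y} :
    p ∈ relCod α β ↔ ∃ x, α x = p.1 ∧ β x = p.2 := by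
  simp [relCod, Prod.ext_iff]

theorem exists_chain_relDom {α β : X →ₗ[k] Y} {t : ℕ} {y : Fin (t + 1) → Y}
    (hy : y ∈ chains (relCod α β) (t + 1)) :
    ∃ x ∈ chains (relDom α β) t, ∀ i : Fin t, α (x i) = y i.castSucc ∧ β (x i) = y i.succ := by
  choose x hx using fun i : Fin t => mem_relCod.1 (hy i (by omega))
  refine ⟨x, fun i h => mem_relDom.2 ?_, hx⟩
  exact (hx ⟨i, by omega⟩).2.trans (hx ⟨i + 1, h⟩).1.symm

theorem finrank_chains_relCod (α β : X →ₗ[k] Y) (h : ∀ x, α x = 0 → β x = 0 → x = 0) (t : ℕ) :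
    Module.finrank k (chains (relCod α β) (t + 2)) =
      Module.finrank k (chains (relDom α β) (t + 1)) := by
  let Ψ : (Fin (t + 1) → X) →ₗ[k] (Fin (t + 2) → Y) :=
    { toFun := fun x => Fin.cons (α := fun _ => Y) (α (x 0)) fun i => β (x i)
      map_add' := by
        intro p q
        ext i
        refine Fin.cases ?_ (fun i => ?_) i <;> simp
      map_smul' := by
        intro c p
        ext i
        refine Fin.cases ?_ (fun i => ?_) i <;> simp }
  have hΨ0 : ∀ x, Ψ x 0 = α (x 0) := fun _ => rfl
  have hΨs : ∀ x i, Ψ x (Fin.succ i) = β (x i) := fun _ _ => rfl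
  have hΨ : ∀ x ∈ chains (relDom α β) (t + 1), ∀ i : Fin (t + 1), Ψ x i.castSucc = α (x i) := by
    intro x hx i
    refine Fin.cases ?_ (fun i => ?_) i
    · rfl
    · exact mem_relDom.1 (hx i (by omega))
  have hmap : (chains (relDom α β) (t + 1)).map Ψ = chains (relCod α β) (t + 2) := by
    ext y
    constructor
    · rintro ⟨x, hx, rfl⟩ i hi
      exact mem_relCod.2 ⟨x ⟨i, by omega⟩, (hΨ x hx ⟨i, by omega⟩).symm, rfl⟩
    · intro hy
      obtain ⟨x, hx, hxy⟩ := exists_chain_relDom hy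
      refine ⟨x, hx, ?_⟩
      ext i
      refine Fin.cases ?_ (fun i => ?_) i
      · exact (hxy 0).1
      · exact (hxy i).2
  have hinj : Function.Injective (Ψ ∘ₗ (chains (relDom α β) (t + 1)).subtype) := by
    refine (injective_iff_map_eq_zero _).2 ?_
    rintro ⟨x, hx⟩ h0
    ext i
    have h0' : Ψ x = 0 := h0
    refine h _ ?_ ?_
    · rw [← hΨ x hx, h0']; rfl
    · rw [← hΨs x, h0']; rfl
  rw [← hmap, ← LinearMap.finrank_range_of_inj hinj, LinearMap.range_comp, Submodule.range_subtype]

end Chains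

/-! ### Morphisms of Kronecker representations -/

/-- The dimension at the sink (`false`) or at the source (`true`). -/
def KRep.dim (M : KRep k) : Bool → ℕ
  | false => M.d1
  | true => M.d2

/-- The component of a morphism at the sink (`false`) or at the source (`true`). -/
def KHom.lin {M N : KRep k} (f : KHom M N) :
    (b : Bool) → (Fin (M.dim b) → k) →ₗ[k] (Fin (N.dim b) → k)
  | false => f.f1.mulVecLin
  | true => f.f2.mulVecLin

theorem KHom.comm_a_apply {M N : KRep k} (f : KHom M N) (x : Fin M.d2 → k) :
    f.f1 *ᵥ (M.A *ᵥ x) = N.A *ᵥ (f.f2 *ᵥ x) := by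
  rw [Matrix.mulVec_mulVec, Matrix.mulVec_mulVec, f.comm_a]

theorem KHom.comm_b_apply {M N : KRep k} (f : KHom M N) (x : Fin M.d2 → k) :
    f.f1 *ᵥ (M.B *ᵥ x) = N.B *ᵥ (f.f2 *ᵥ x) := by
  rw [Matrix.mulVec_mulVec, Matrix.mulVec_mulVec, f.comm_b]

/-- A morphism from a pair of commuting linear maps. -/
def KHom.ofLin {M N : KRep k} (F : (Fin M.d1 → k) →ₗ[k] (Fin N.d1 → k))
    (G : (Fin M.d2 → k) →ₗ[k] (Fin N.d2 → k)) (hA : ∀ x, F (M.A *ᵥ x) = N.A *ᵥ G x)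
    (hB : ∀ x, F (M.B *ᵥ x) = N.B *ᵥ G x) : KHom M N where
  f1 := LinearMap.toMatrix' F
  f2 := LinearMap.toMatrix' G
  comm_a := by
    refine Matrix.mulVec_injective (funext fun x => ?_)
    rw [← Matrix.mulVec_mulVec, ← Matrix.mulVec_mulVec, LinearMap.toMatrix'_mulVec,
      LinearMap.toMatrix'_mulVec, hA]
  comm_b := by
    refine Matrix.mulVec_injective (funext fun x => ?_)
    rw [← Matrix.mulVec_mulVec, ← Matrix.mulVec_mulVec, LinearMap.toMatrix'_mulVec,
      LinearMap.toMatrix'_mulVec, hB]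

theorem KHom.ofLin_lin_false {M N : KRep k} (F : (Fin M.d1 → k) →ₗ[k] (Fin N.d1 → k))
    (G : (Fin M.d2 → k) →ₗ[k] (Fin N.d2 → k)) (hA : ∀ x, F (M.A *ᵥ x) = N.A *ᵥ G x)
    (hB : ∀ x, F (M.B *ᵥ x) = N.B *ᵥ G x) : (KHom.ofLin F G hA hB).lin false = F :=
  LinearMap.ext fun x => LinearMap.toMatrix'_mulVec F x

theorem KHom.ofLin_lin_true {M N : KRep k} (F : (Fin M.d1 → k) →ₗ[k] (Fin N.d1 → k))
    (G : (Fin M.d2 → k) →ₗ[k] (Fin N.d2 → k)) (hA : ∀ x, F (M.A *ᵥ x) = N.A *ᵥ G x)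
    (hB : ∀ x, F (M.B *ᵥ x) = N.B *ᵥ G x) : (KHom.ofLin F G hA hB).lin true = G :=
  LinearMap.ext fun x => LinearMap.toMatrix'_mulVec G x

/-- The zero morphism. -/
def KHom.zero (M N : KRep k) : KHom M N := ⟨0, 0, by simp, by simp⟩

/-- Composition of morphisms. -/
def KHom.comp {M N T : KRep k} (g : KHom N T) (f : KHom M N) : KHom M T where
  f1 := g.f1 * f.f1
  f2 := g.f2 * f.f2
  comm_a := by rw [Matrix.mul_assoc, f.comm_a, ← Matrix.mul_assoc, g.comm_a, Matrix.mul_assoc]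
  comm_b := by rw [Matrix.mul_assoc, f.comm_b, ← Matrix.mul_assoc, g.comm_b, Matrix.mul_assoc]

/-- Sum of morphisms. -/
def KHom.add {M N : KRep k} (f g : KHom M N) : KHom M N where
  f1 := f.f1 + g.f1
  f2 := f.f2 + g.f2
  comm_a := by rw [Matrix.add_mul, Matrix.mul_add, f.comm_a, g.comm_a]
  comm_b := by rw [Matrix.add_mul, Matrix.mul_add, f.comm_b, g.comm_b]

theorem KHom.comp_lin {M N T : KRep k} (g : KHom N T) (f : KHom M N) (b : Bool)
    (x : Fin (M.dim b) → k) : (g.comp f).lin b x = g.lin b (f.lin b x) := by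
  cases b
  · exact (Matrix.mulVec_mulVec x g.f1 f.f1).symm
  · exact (Matrix.mulVec_mulVec x g.f2 f.f2).symm

theorem KHom.add_lin {M N : KRep k} (f g : KHom M N) (b : Bool)
    (x : Fin (M.dim b) → k) : (f.add g).lin b x = f.lin b x + g.lin b x := by
  cases b
  · exact Matrix.add_mulVec f.f1 g.f1 x
  · exact Matrix.add_mulVec f.f2 g.f2 x

section DirectSum

variable (M N : KRep k)

theorem KRep.dsum_mulVec {m m' n n' : ℕ} (A : Matrix (Fin m) (Fin n) k)
    (A' : Matrix (Fin m') (Fin n') k) (x : Fin (n + n') → k) :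
    Matrix.reindex finSumFinEquiv finSumFinEquiv (Matrix.fromBlocks A 0 0 A') *ᵥ x =
      Fin.append (A *ᵥ fun i => x (Fin.castAdd n' i)) (A' *ᵥ fun i => x (Fin.natAdd n i)) := by
  ext i
  refine Fin.addCases (fun i => ?_) (fun i => ?_) i <;>
    simp [Matrix.mulVec, dotProduct, Fin.sum_univ_add, Matrix.reindex_apply]

theorem KRep.dsum_mulVec_append {m m' n n' : ℕ} (A : Matrix (Fin m) (Fin n) k)
    (A' : Matrix (Fin m') (Fin n') k) (x : Fin n → k) (y : Fin n' → k) :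
    Matrix.reindex finSumFinEquiv finSumFinEquiv (Matrix.fromBlocks A 0 0 A') *ᵥ Fin.append x y =
      Fin.append (A *ᵥ x) (A' *ᵥ y) := by
  rw [KRep.dsum_mulVec]
  simp

theorem KRep.dim_dsum (b : Bool) : (M.dsum N).dim b = M.dim b + N.dim b := by
  cases b <;> rfl

/-- The first projection. -/
def KHom.fst : KHom (M.dsum N) M :=
  KHom.ofLin (LinearMap.funLeft k k (Fin.castAdd N.d1)) (LinearMap.funLeft k k (Fin.castAdd N.d2))
    (fun x => funext fun i =>
      (congrFun (KRep.dsum_mulVec M.A N.A x) _).trans (Fin.append_left _ _ i))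
    (fun x => funext fun i =>
      (congrFun (KRep.dsum_mulVec M.B N.B x) _).trans (Fin.append_left _ _ i))

/-- The second projection. -/
def KHom.snd : KHom (M.dsum N) N :=
  KHom.ofLin (LinearMap.funLeft k k (Fin.natAdd M.d1)) (LinearMap.funLeft k k (Fin.natAdd M.d2))
    (fun x => funext fun i =>
      (congrFun (KRep.dsum_mulVec M.A N.A x) _).trans (Fin.append_right _ _ i))
    (fun x => funext fun i =>
      (congrFun (KRep.dsum_mulVec M.B N.B x) _).trans (Fin.append_right _ _ i))

/-- Extension of a vector by zeros on the right. -/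
def appendZero (m n : ℕ) : (Fin m → k) →ₗ[k] (Fin (m + n) → k) where
  toFun x := Fin.append x 0
  map_add' x y := by ext i; refine Fin.addCases (fun i => ?_) (fun i => ?_) i <;> simp
  map_smul' c x := by ext i; refine Fin.addCases (fun i => ?_) (fun i => ?_) i <;> simp

/-- Extension of a vector by zeros on the left. -/
def zeroAppend (m n : ℕ) : (Fin n → k) →ₗ[k] (Fin (m + n) → k) where
  toFun x := Fin.append 0 x
  map_add' x y := by ext i; refine Fin.addCases (fun i => ?_) (fun i => ?_) i <;> simp
  map_smul' c x := by ext i; refine Fin.addCases (fun i => ?_) (fun i => ?_) i <;> simp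

theorem appendZero_apply {m n : ℕ} (x : Fin m → k) (i : Fin (m + n)) :
    appendZero m n x i = if h : (i : ℕ) < m then x ⟨i, h⟩ else 0 := by
  refine Fin.addCases (fun i => ?_) (fun i => ?_) i <;> simp [appendZero]

theorem zeroAppend_apply {m n : ℕ} (x : Fin n → k) (i : Fin (m + n)) :
    zeroAppend m n x i = if h : m ≤ (i : ℕ) then x ⟨i - m, by omega⟩ else 0 := by
  refine Fin.addCases (fun i => ?_) (fun i => ?_) i <;> simp [zeroAppend]

/-- The first injection. -/
def KHom.inl : KHom M (M.dsum N) :=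
  KHom.ofLin (appendZero _ _) (appendZero _ _)
    (fun x => ((KRep.dsum_mulVec_append M.A N.A x 0).trans (by rw [Matrix.mulVec_zero]; rfl)).symm)
    (fun x => ((KRep.dsum_mulVec_append M.B N.B x 0).trans (by rw [Matrix.mulVec_zero]; rfl)).symm)

/-- The second injection. -/
def KHom.inr : KHom N (M.dsum N) :=
  KHom.ofLin (zeroAppend _ _) (zeroAppend _ _)
    (fun x => ((KRep.dsum_mulVec_append M.A N.A 0 x).trans (by rw [Matrix.mulVec_zero]; rfl)).symm)
    (fun x => ((KRep.dsum_mulVec_append M.B N.B 0 x).trans (by rw [Matrix.mulVec_zero]; rfl)).symm)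

variable {M N} (b : Bool)

theorem KHom.fst_apply (x : Fin ((M.dsum N).dim b) → k) (i : Fin (M.dim b)) :
    (KHom.fst M N).lin b x i = x ⟨i, by have := KRep.dim_dsum M N b; omega⟩ := by
  cases b
  · rw [KHom.fst, KHom.ofLin_lin_false]; rfl
  · rw [KHom.fst, KHom.ofLin_lin_true]; rfl

theorem KHom.snd_apply (x : Fin ((M.dsum N).dim b) → k) (i : Fin (N.dim b)) :
    (KHom.snd M N).lin b x i = x ⟨M.dim b + i, by have := KRep.dim_dsum M N b; omega⟩ := by
  cases b
  · rw [KHom.snd, KHom.ofLin_lin_false]; rfl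
  · rw [KHom.snd, KHom.ofLin_lin_true]; rfl

theorem KHom.inl_apply (x : Fin (M.dim b) → k) (i : Fin ((M.dsum N).dim b)) :
    (KHom.inl M N).lin b x i = if h : (i : ℕ) < M.dim b then x ⟨i, h⟩ else 0 := by
  cases b
  · exact (congrFun (LinearMap.toMatrix'_mulVec (appendZero M.d1 N.d1) x) i).trans
      (appendZero_apply x i)
  · exact (congrFun (LinearMap.toMatrix'_mulVec (appendZero M.d2 N.d2) x) i).trans
      (appendZero_apply x i)

theorem KHom.inr_apply (x : Fin (N.dim b) → k) (i : Fin ((M.dsum N).dim b)) :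
    (KHom.inr M N).lin b x i = if h : M.dim b ≤ (i : ℕ) then
      x ⟨i - M.dim b, by have := KRep.dim_dsum M N b; omega⟩ else 0 := by
  cases b
  · exact (congrFun (LinearMap.toMatrix'_mulVec (zeroAppend M.d1 N.d1) x) i).trans
      (zeroAppend_apply x i)
  · exact (congrFun (LinearMap.toMatrix'_mulVec (zeroAppend M.d2 N.d2) x) i).trans
      (zeroAppend_apply x i)

@[simp] theorem KHom.fst_inl (x : Fin (M.dim b) → k) :
    (KHom.fst M N).lin b ((KHom.inl M N).lin b x) = x := by
  ext i; simp [KHom.fst_apply, KHom.inl_apply]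

@[simp] theorem KHom.snd_inl (x : Fin (M.dim b) → k) :
    (KHom.snd M N).lin b ((KHom.inl M N).lin b x) = 0 := by
  ext i; simp [KHom.snd_apply, KHom.inl_apply]

@[simp] theorem KHom.fst_inr (x : Fin (N.dim b) → k) :
    (KHom.fst M N).lin b ((KHom.inr M N).lin b x) = 0 := by
  ext i; simp [KHom.fst_apply, KHom.inr_apply]

@[simp] theorem KHom.snd_inr (x : Fin (N.dim b) → k) :
    (KHom.snd M N).lin b ((KHom.inr M N).lin b x) = x := by
  ext i; simp [KHom.snd_apply, KHom.inr_apply]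

theorem KHom.dsum_ext {x y : Fin ((M.dsum N).dim b) → k}
    (h1 : (KHom.fst M N).lin b x = (KHom.fst M N).lin b y)
    (h2 : (KHom.snd M N).lin b x = (KHom.snd M N).lin b y) : x = y := by
  ext i
  have hd := KRep.dim_dsum M N b
  by_cases h : (i : ℕ) < M.dim b
  · simpa [KHom.fst_apply] using congrFun h1 ⟨i, h⟩
  · have := congrFun h2 ⟨i - M.dim b, by omega⟩
    rw [KHom.snd_apply, KHom.snd_apply] at this
    have e : (⟨M.dim b + (i - M.dim b), by omega⟩ : Fin ((M.dsum N).dim b)) = i :=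
      Fin.ext (by simp; omega)
    simpa [e] using this

theorem KHom.inl_add_inr (x : Fin ((M.dsum N).dim b) → k) :
    (KHom.inl M N).lin b ((KHom.fst M N).lin b x) +
      (KHom.inr M N).lin b ((KHom.snd M N).lin b x) = x := by
  apply KHom.dsum_ext <;> simp

/-- The morphism into a direct sum with given components. -/
def KHom.lift {T : KRep k} (f : KHom T M) (g : KHom T N) : KHom T (M.dsum N) :=
  ((KHom.inl M N).comp f).add ((KHom.inr M N).comp g)

@[simp] theorem KHom.fst_lift {T : KRep k} (f : KHom T M) (g : KHom T N) (x) :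
    (KHom.fst M N).lin b ((f.lift g).lin b x) = f.lin b x := by
  simp [KHom.lift, KHom.add_lin, KHom.comp_lin]

@[simp] theorem KHom.snd_lift {T : KRep k} (f : KHom T M) (g : KHom T N) (x) :
    (KHom.snd M N).lin b ((f.lift g).lin b x) = g.lin b x := by
  simp [KHom.lift, KHom.add_lin, KHom.comp_lin]

end DirectSum

/-! ### Morphisms between indecomposable preinjectives -/

theorem KRep.dim_Inj (i : ℕ) (b : Bool) : (KRep.Inj k i).dim b = i + b.toNat := by
  cases b <;> rfl

theorem KRep.Inj_A_mulVec (i : ℕ) (x : Fin (i + 1) → k) (r : Fin i) :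
    ((KRep.Inj k i).A *ᵥ x) r = x r.castSucc := by
  simp only [KRep.Inj, Matrix.mulVec, dotProduct, Matrix.of_apply, ite_mul, one_mul, zero_mul]
  rw [Finset.sum_eq_single r.castSucc]
  · simp
  · intro q _ hq
    rw [if_neg]
    contrapose! hq
    exact Fin.ext hq.symm
  · exact fun h => absurd (Finset.mem_univ _) h

theorem KRep.Inj_B_mulVec (i : ℕ) (x : Fin (i + 1) → k) (r : Fin i) :
    ((KRep.Inj k i).B *ᵥ x) r = x r.succ := by
  simp only [KRep.Inj, Matrix.mulVec, dotProduct, Matrix.of_apply, ite_mul, one_mul, zero_mul]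
  rw [Finset.sum_eq_single r.succ]
  · simp
  · intro q _ hq
    rw [if_neg]
    contrapose! hq
    exact Fin.ext hq.symm
  · exact fun h => absurd (Finset.mem_univ _) h

/-- The map that drops the first `s` coordinates and keeps the next `e`. -/
def dropCoords {d e s : ℕ} (h : s + e ≤ d) : (Fin d → k) →ₗ[k] (Fin e → k) :=
  LinearMap.funLeft k k fun r => ⟨r + s, by omega⟩

theorem KRep.Inj_A_mulVec_dropCoords {i j s : ℕ} (h : s + j ≤ i) (x : Fin (i + 1) → k) :
    dropCoords h ((KRep.Inj k i).A *ᵥ x) =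
      (KRep.Inj k j).A *ᵥ dropCoords (show s + (j + 1) ≤ i + 1 by omega) x :=
  funext fun r => (KRep.Inj_A_mulVec i x _).trans (KRep.Inj_A_mulVec j
    (dropCoords (show s + (j + 1) ≤ i + 1 by omega) x) r).symm

theorem KRep.Inj_B_mulVec_dropCoords {i j s : ℕ} (h : s + j ≤ i) (x : Fin (i + 1) → k) :
    dropCoords h ((KRep.Inj k i).B *ᵥ x) =
      (KRep.Inj k j).B *ᵥ dropCoords (show s + (j + 1) ≤ i + 1 by omega) x := by
  refine funext fun r => (KRep.Inj_B_mulVec i x ⟨r + s, ?_⟩).trans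
    (Eq.trans (congrArg x (Fin.ext ?_)) (KRep.Inj_B_mulVec j
    (dropCoords (show s + (j + 1) ≤ i + 1 by omega) x) r).symm)
  · have : (r : ℕ) < j := r.2
    omega
  · exact Nat.add_right_comm (r : ℕ) s 1

/-- The morphism `I i → I j` that drops the first `s` coordinates. -/
def KHom.shift {i j s : ℕ} (h : s + j ≤ i) : KHom (KRep.Inj k i) (KRep.Inj k j) :=
  KHom.ofLin (dropCoords h) (dropCoords (show s + (j + 1) ≤ i + 1 by omega))
    (KRep.Inj_A_mulVec_dropCoords h) (KRep.Inj_B_mulVec_dropCoords h)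

theorem KHom.shift_apply {i j s : ℕ} (h : s + j ≤ i) (b : Bool)
    (x : Fin ((KRep.Inj k i).dim b) → k) (r : Fin ((KRep.Inj k j).dim b)) :
    (KHom.shift h).lin b x r = x ⟨r + s, by
      have := KRep.dim_Inj (k := k) i b; have := KRep.dim_Inj (k := k) j b; omega⟩ := by
  cases b
  · exact congrFun (LinearMap.toMatrix'_mulVec (dropCoords h) x) r
  · exact congrFun
      (LinearMap.toMatrix'_mulVec (dropCoords (show s + (j + 1) ≤ i + 1 by omega)) x) r

/-- The first `m` coordinates of `x` vanish. -/
def VanishBelow (m : ℕ) {d : ℕ} (x : Fin d → k) : Prop := ∀ r : Fin d, (r : ℕ) < m → x r = 0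

theorem KHom.exists_shift_eq {i j s : ℕ} (h : s + j ≤ i) (b : Bool)
    (y : Fin ((KRep.Inj k j).dim b) → k) :
    ∃ x, (KHom.shift h).lin b x = y ∧ ∀ q, VanishBelow q y → VanishBelow (q + s) x := by
  refine ⟨fun r => if h : s ≤ r ∧ r - s < (KRep.Inj k j).dim b then y ⟨r - s, h.2⟩ else 0, ?_, ?_⟩
  · ext r
    simp [KHom.shift_apply]
  · intro q hq r hr
    dsimp only
    split_ifs with h
    · exact hq _ (by simp; omega)
    · rfl


/-! ### Epimorphisms at a vertex between preinjectives -/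

/-- There is a morphism `M → N` whose component at `b` maps the vectors that vanish
below `m` onto everything. -/
def Covers (b : Bool) (m : ℕ) (M N : KRep k) : Prop :=
  ∃ f : KHom M N, ∀ y, ∃ x, VanishBelow m x ∧ f.lin b x = y

theorem covers_zero (b : Bool) : Covers b 0 (KRep.zero : KRep k) KRep.zero :=
  ⟨KHom.zero _ _, fun y => ⟨0, fun _ _ => rfl, by
    cases b <;> exact Subsingleton.elim (α := Fin 0 → k) _ _⟩⟩

section Covers

variable {b : Bool} {m i j : ℕ} {M N : KRep k}

theorem VanishBelow.add {d : ℕ} {x y : Fin d → k} (hx : VanishBelow m x) (hy : VanishBelow m y) :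
    VanishBelow m (x + y) := fun r hr => by simp [hx r hr, hy r hr]

theorem VanishBelow.mono {q d : ℕ} {x : Fin d → k} (hx : VanishBelow m x) (h : q ≤ m) :
    VanishBelow q x := fun r hr => hx r (hr.trans_le h)

theorem VanishBelow.inl {x : Fin (M.dim b) → k} (hx : VanishBelow m x) :
    VanishBelow m ((KHom.inl M N).lin b x) := by
  intro r hr
  rw [KHom.inl_apply]
  split_ifs with h
  · exact hx _ hr
  · rfl

theorem vanishBelow_inr (h : m ≤ M.dim b) (x : Fin (N.dim b) → k) :
    VanishBelow m ((KHom.inr M N).lin b x) := by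
  intro r hr
  rw [KHom.inr_apply, dif_neg (by omega)]

theorem VanishBelow.fst {x : Fin ((M.dsum N).dim b) → k} (hx : VanishBelow m x) :
    VanishBelow m ((KHom.fst M N).lin b x) := by
  intro r hr
  rw [KHom.fst_apply]
  exact hx _ hr

theorem Covers.dsum_left {T : KRep k} (h : Covers b 0 M N) (hm : m ≤ T.dim b) :
    Covers b m (T.dsum M) N := by
  obtain ⟨f, hf⟩ := h
  refine ⟨f.comp (KHom.snd _ _), fun y => ?_⟩
  obtain ⟨x, -, hx⟩ := hf y
  exact ⟨(KHom.inr T M).lin b x, vanishBelow_inr hm x, by simp [KHom.comp_lin, hx]⟩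

theorem Covers.dsum_right (hij : m + j ≤ i)
    (h : Covers b (m + (j + b.toNat)) ((KRep.Inj k i).dsum M) N) :
    Covers b m ((KRep.Inj k i).dsum M) ((KRep.Inj k j).dsum N) := by
  obtain ⟨f, hf⟩ := h
  refine ⟨((KHom.shift hij).comp (KHom.fst _ _)).lift f, fun y => ?_⟩
  obtain ⟨z, hz, hzv⟩ := KHom.exists_shift_eq hij b ((KHom.fst _ _).lin b y)
  obtain ⟨x, hxv, hx⟩ := hf ((KHom.snd _ _).lin b y - f.lin b ((KHom.inl _ _).lin b z))
  refine ⟨(KHom.inl _ _).lin b z + x, VanishBelow.add (VanishBelow.inl ?_) (hxv.mono (by omega)),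
    KHom.dsum_ext b ?_ ?_⟩
  · exact (hzv 0 fun r hr => absurd hr (by omega)).mono (by omega)
  · have : (KHom.shift hij).lin b ((KHom.fst _ _).lin b x) = 0 := by
      ext r
      rw [KHom.shift_apply]
      have hr := r.2.trans_eq (KRep.dim_Inj j b)
      exact hxv.fst _ (by simp; omega)
    simp [KHom.comp_lin, hz, this]
  · simp [hx]

theorem Covers.dsum_both {q l : ℕ} (hji : j ≤ i) (hil : i ≤ l) (hq : q ≤ j + b.toNat)
    (h : Covers b q ((KRep.Inj k l).dsum M) N) :
    Covers b (q + (i - j)) ((KRep.Inj k i).dsum ((KRep.Inj k l).dsum M))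
      ((KRep.Inj k j).dsum N) := by
  obtain ⟨f, hf⟩ := h
  have h1 : i - j + j ≤ i := by omega
  have h2 : 0 + j ≤ l := by omega
  refine ⟨(((KHom.shift h1).comp (KHom.fst _ _)).add
    ((KHom.shift h2).comp ((KHom.fst _ _).comp (KHom.snd _ _)))).lift (f.comp (KHom.snd _ _)),
    fun y => ?_⟩
  obtain ⟨z, hz, -⟩ := KHom.exists_shift_eq h2 b ((KHom.fst _ _).lin b y)
  obtain ⟨x, hxv, hx⟩ := hf ((KHom.snd _ _).lin b y - f.lin b ((KHom.inl _ _).lin b z))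
  obtain ⟨w, hw, hwv⟩ := KHom.exists_shift_eq h1 b
    (-(KHom.shift h2).lin b ((KHom.fst _ _).lin b x))
  refine ⟨(KHom.inl _ _).lin b w + (KHom.inr _ _).lin b ((KHom.inl _ _).lin b z + x),
    VanishBelow.add (VanishBelow.inl (hwv q ?_)) (vanishBelow_inr ?_ _), KHom.dsum_ext b ?_ ?_⟩
  · intro r hr
    rw [Pi.neg_apply, KHom.shift_apply, hxv.fst _ (by simpa using hr), neg_zero]
  · rw [KRep.dim_Inj]; omega
  · simp [KHom.comp_lin, KHom.add_lin, hz, hw]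
  · simp [KHom.comp_lin, hx]

end Covers

/-- The preinjective representation with the given list of indices of summands. -/
def KRep.injSum (k : Type) [Field k] (l : List ℕ) : KRep k :=
  KRep.dsumList (l.map (KRep.Inj k))

theorem KRep.injSum_cons (i : ℕ) (l : List ℕ) :
    KRep.injSum k (i :: l) = (KRep.Inj k i).dsum (KRep.injSum k l) := rfl

/-- The dimension at `b` of the summands with index below `s`. -/
def massBelow (b : Bool) (s : ℕ) (l : List ℕ) : ℕ :=
  (l.map fun i => if i < s then i + b.toNat else 0).sum

theorem massBelow_cons (b : Bool) (s i : ℕ) (l : List ℕ) :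
    massBelow b s (i :: l) = (if i < s then i + b.toNat else 0) + massBelow b s l := by
  simp [massBelow]

theorem massBelow_eq_zero {b : Bool} {s : ℕ} {l : List ℕ} (h : ∀ i ∈ l, s ≤ i) :
    massBelow b s l = 0 := by
  rw [massBelow, List.sum_eq_zero]
  intro x hx
  obtain ⟨i, hi, rfl⟩ := List.mem_map.1 hx
  rw [if_neg (by have := h i hi; omega)]

theorem KRep.dim_injSum_nil (b : Bool) : (KRep.injSum k []).dim b = 0 := by cases b <;> rfl

theorem KRep.dim_injSum_cons (b : Bool) (i : ℕ) (l : List ℕ) :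
    (KRep.injSum k (i :: l)).dim b = i + b.toNat + (KRep.injSum k l).dim b := by
  rw [KRep.injSum_cons, KRep.dim_dsum, KRep.dim_Inj]

theorem covers_injSum (b : Bool) (c u : List ℕ) (m : ℕ) (hc : c.Pairwise (· ≤ ·))
    (hu : u.Pairwise (· ≤ ·)) (hu0 : ∀ i ∈ u, 0 < i + b.toNat) (hm : ∀ i ∈ c.head?, m ≤ i + b.toNat)
    (hs : ∀ s, massBelow b s c ≤ m + massBelow b s u)
    (ht : (KRep.injSum k c).dim b = m + (KRep.injSum k u).dim b) :
    Covers b m (KRep.injSum k c) (KRep.injSum k u) := by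
  induction c generalizing m u with
  | nil =>
    rw [KRep.dim_injSum_nil] at ht
    cases u with
    | nil =>
      rw [KRep.dim_injSum_nil] at ht
      obtain rfl : m = 0 := by omega
      exact covers_zero b
    | cons j u =>
      rw [KRep.dim_injSum_cons] at ht
      have := hu0 j (by simp)
      omega
  | cons i c ihc =>
    obtain ⟨hic, hc'⟩ := List.pairwise_cons.1 hc
    have hmi : m ≤ i + b.toNat := hm i rfl
    induction u generalizing m with
    | nil =>
      rw [KRep.dim_injSum_cons, KRep.dim_injSum_nil] at ht
      rw [KRep.injSum_cons]
      refine (ihc [] 0 hc' hu hu0 (by simp) (fun s => ?_)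
        (by rw [KRep.dim_injSum_nil]; omega)).dsum_left (by rw [KRep.dim_Inj]; exact hmi)
      have := hs s
      rw [massBelow_cons] at this
      by_cases h : i < s
      · rw [if_pos h] at this; omega
      · rw [massBelow_eq_zero fun x hx => (not_lt.1 h).trans (hic x hx)]; omega
    | cons j u ihu =>
      obtain ⟨hju, hu'⟩ := List.pairwise_cons.1 hu
      have hu0' : ∀ i ∈ u, 0 < i + b.toNat := fun x hx => hu0 x (by simp [hx])
      rw [KRep.dim_injSum_cons, KRep.dim_injSum_cons] at ht
      rcases hmi.eq_or_lt with rfl | hlt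
      · rw [KRep.injSum_cons i]
        refine (ihc (j :: u) 0 hc' hu hu0 (by simp) (fun s => ?_)
          (by rw [KRep.dim_injSum_cons]; omega)).dsum_left (by rw [KRep.dim_Inj])
        have := hs s
        rw [massBelow_cons b s i] at this
        by_cases h : i < s
        · rw [if_pos h] at this; omega
        · rw [massBelow_eq_zero fun x hx => (not_lt.1 h).trans (hic x hx)]; omega
      have hji : j ≤ i := by
        by_contra! h
        have := hs (i + 1)
        rw [massBelow_cons, massBelow_eq_zero (l := j :: u) (by
          simp only [List.mem_cons, forall_eq_or_imp]
          exact ⟨h, fun x hx => h.trans_le (hju x hx)⟩)] at this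
        simp at this
        omega
      by_cases hmj : m + j ≤ i
      · rw [KRep.injSum_cons i, KRep.injSum_cons j]
        refine Covers.dsum_right hmj ?_
        rw [← KRep.injSum_cons i]
        refine ihu (m + (j + b.toNat)) hu' hu0' (by simp; omega) (fun s => ?_)
          (by rw [KRep.dim_injSum_cons]; omega) (by omega)
        have := hs s
        rw [massBelow_cons b s j] at this
        split_ifs at this <;> omega
      · obtain ⟨q, rfl⟩ : ∃ q, m = q + (i - j) := ⟨m + j - i, by omega⟩
        cases c with
        | nil => rw [KRep.dim_injSum_nil] at ht; omega
        | cons l c =>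
          have hil : i ≤ l := hic l (by simp)
          rw [KRep.injSum_cons i, KRep.injSum_cons l, KRep.injSum_cons j]
          refine Covers.dsum_both hji hil (by omega) ?_
          rw [← KRep.injSum_cons l]
          refine ihc u q hc' hu' hu0' (by simp; omega) (fun s => ?_) (by omega)
          have := hs s
          rw [massBelow_cons b s i, massBelow_cons b s j] at this
          by_cases h : i < s
          · rw [if_pos h, if_pos (by omega)] at this; omega
          · rw [massBelow_eq_zero fun x hx => (not_lt.1 h).trans (hic x hx)]; omega

/-! ### Preinjective representations with prescribed multiplicities -/

/-- The list of indices in which `i` occurs `a i` times, for `s ≤ i < s + n`. -/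
def indexList (a : ℕ → ℕ) (s n : ℕ) : List ℕ :=
  (List.range' s n).flatMap fun i => List.replicate (a i) i

theorem KRep.multi_eq_injSum (a : ℕ → ℕ) (n : ℕ) :
    KRep.multi k a n = KRep.injSum k (indexList a 0 (n + 1)) := by
  rw [KRep.multi, KRep.injSum, indexList, List.map_flatMap, List.range_eq_range']
  simp

theorem indexList_succ (a : ℕ → ℕ) (s n : ℕ) :
    indexList a s (n + 1) = List.replicate (a s) s ++ indexList a (s + 1) n := by
  simp [indexList, List.range'_succ]

theorem le_of_mem_indexList {a : ℕ → ℕ} {s n i : ℕ} (h : i ∈ indexList a s n) : s ≤ i := by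
  simp only [indexList, List.mem_flatMap, List.mem_range'_1, List.mem_replicate] at h
  obtain ⟨j, hj, -, rfl⟩ := h
  exact hj.1

theorem pairwise_indexList (a : ℕ → ℕ) (s n : ℕ) : (indexList a s n).Pairwise (· ≤ ·) := by
  induction n generalizing s with
  | zero => simp [indexList]
  | succ n ih =>
    rw [indexList_succ, List.pairwise_append]
    refine ⟨List.pairwise_replicate.2 (Or.inr le_rfl), ih _, fun x hx y hy => ?_⟩
    rw [List.eq_of_mem_replicate hx]
    exact (Nat.le_succ s).trans (le_of_mem_indexList hy)

theorem sum_map_indexList (a w : ℕ → ℕ) (s n : ℕ) :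
    ((indexList a s n).map w).sum = ∑ i ∈ Finset.Ico s (s + n), w i * a i := by
  induction n generalizing s with
  | zero => simp [indexList]
  | succ n ih =>
    rw [indexList_succ, List.map_append, List.sum_append, ih,
      Finset.sum_eq_sum_Ico_succ_bot (show s < s + (n + 1) by omega), add_right_comm s, add_assoc s]
    simp [mul_comm]

theorem KRep.dim_injSum (b : Bool) (l : List ℕ) :
    (KRep.injSum k l).dim b = (l.map fun i => i + b.toNat).sum := by
  induction l with
  | nil => exact KRep.dim_injSum_nil b
  | cons i l ih => rw [KRep.dim_injSum_cons, ih, List.map_cons, List.sum_cons]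

theorem sum_ite_lt_le_of_tail_le {p n : ℕ} {f g : ℕ → ℕ}
    (hle : ∀ t, p ≤ t → ∑ i ∈ Finset.Icc t n, g i ≤ ∑ i ∈ Finset.Icc t n, f i)
    (heq : ∑ i ∈ Finset.Icc p n, f i = ∑ i ∈ Finset.Icc p n, g i) (s : ℕ) :
    ∑ i ∈ Finset.Icc p n, (if i < s then f i else 0) ≤
      ∑ i ∈ Finset.Icc p n, (if i < s then g i else 0) := by
  have key : ∀ h : ℕ → ℕ, ∑ i ∈ Finset.Icc p n, (if i < s then h i else 0) +
      ∑ i ∈ Finset.Icc (max p s) n, h i = ∑ i ∈ Finset.Icc p n, h i := by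
    intro h
    rw [← Finset.sum_filter, ← Finset.sum_filter_add_sum_filter_not (Finset.Icc p n) (· < s)]
    congr 2
    ext i
    simp only [Finset.mem_Icc, Finset.mem_filter]
    omega
  have h1 := key f
  have h2 := key g
  have h3 := hle (max p s) (le_max_left _ _)
  omega

/-- Tail domination of multiplicities, weighted by dimension, gives a morphism that is
bijective at the vertex `b`. -/
theorem exists_bijective_of_tail_le (b : Bool) {p n : ℕ} {c u : ℕ → ℕ} (hp : 0 < p + b.toNat)
    (hpn : p ≤ n + 1)
    (hle : ∀ t, p ≤ t → ∑ i ∈ Finset.Icc t n, (i + b.toNat) * u i ≤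
      ∑ i ∈ Finset.Icc t n, (i + b.toNat) * c i)
    (heq : ∑ i ∈ Finset.Icc p n, (i + b.toNat) * u i =
      ∑ i ∈ Finset.Icc p n, (i + b.toNat) * c i) :
    ∃ f : KHom (KRep.injSum k (indexList c p (n + 1 - p)))
      (KRep.injSum k (indexList u p (n + 1 - p))), Function.Bijective (f.lin b) := by
  have hI : Finset.Ico p (p + (n + 1 - p)) = Finset.Icc p n := by
    ext i; simp only [Finset.mem_Icc, Finset.mem_Ico]; omega
  have hdim : (KRep.injSum k (indexList c p (n + 1 - p))).dim b =
      (KRep.injSum k (indexList u p (n + 1 - p))).dim b := by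
    rw [KRep.dim_injSum, KRep.dim_injSum, sum_map_indexList, sum_map_indexList, hI, heq]
  obtain ⟨f, hf⟩ := covers_injSum (k := k) b (indexList c p (n + 1 - p))
    (indexList u p (n + 1 - p)) 0 (pairwise_indexList _ _ _) (pairwise_indexList _ _ _)
    (fun i hi => by have := le_of_mem_indexList hi; omega) (by simp)
    (fun s => by
      rw [massBelow, massBelow, sum_map_indexList, sum_map_indexList, hI, zero_add]
      simp only [ite_mul, zero_mul]
      exact sum_ite_lt_le_of_tail_le hle heq.symm s)
    (by rw [zero_add, hdim])
  have hsurj : Function.Surjective (f.lin b) := fun y => (hf y).imp fun _ h => h.2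
  exact ⟨f, (LinearMap.injective_iff_surjective_of_finrank_eq_finrank
    (by simpa using hdim)).2 hsurj, hsurj⟩

/-- The first structure map. -/
def KRep.linA (M : KRep k) : (Fin (M.dim true) → k) →ₗ[k] (Fin (M.dim false) → k) :=
  M.A.mulVecLin

/-- The second structure map. -/
def KRep.linB (M : KRep k) : (Fin (M.dim true) → k) →ₗ[k] (Fin (M.dim false) → k) :=
  M.B.mulVecLin

section StructureMaps

variable {M N : KRep k}

theorem KHom.lin_linA (f : KHom M N) (x) : f.lin false (M.linA x) = N.linA (f.lin true x) :=
  f.comm_a_apply x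

theorem KHom.lin_linB (f : KHom M N) (x) : f.lin false (M.linB x) = N.linB (f.lin true x) :=
  f.comm_b_apply x

theorem KRep.linA_surjective_dsum (hM : Function.Surjective M.linA)
    (hN : Function.Surjective N.linA) : Function.Surjective (M.dsum N).linA := by
  intro y
  obtain ⟨x, hx⟩ := hM ((KHom.fst _ _).lin false y)
  obtain ⟨z, hz⟩ := hN ((KHom.snd _ _).lin false y)
  refine ⟨(KHom.inl _ _).lin true x + (KHom.inr _ _).lin true z, ?_⟩
  rw [map_add, ← KHom.lin_linA, ← KHom.lin_linA, hx, hz, KHom.inl_add_inr]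

theorem KRep.ker_linA_inf_ker_linB_dsum
    (hM : LinearMap.ker M.linA ⊓ LinearMap.ker M.linB = ⊥)
    (hN : LinearMap.ker N.linA ⊓ LinearMap.ker N.linB = ⊥) :
    LinearMap.ker (M.dsum N).linA ⊓ LinearMap.ker (M.dsum N).linB = ⊥ := by
  have key : ∀ {T : KRep k}, LinearMap.ker T.linA ⊓ LinearMap.ker T.linB = ⊥ →
      ∀ (f : KHom (M.dsum N) T) x, (M.dsum N).linA x = 0 → (M.dsum N).linB x = 0 →
        f.lin true x = 0 := by
    intro T hT f x hA hB
    refine (Submodule.mem_bot k).1 (hT ▸ ⟨?_, ?_⟩)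
    · exact (f.lin_linA x).symm.trans (by rw [hA, map_zero])
    · exact (f.lin_linB x).symm.trans (by rw [hB, map_zero])
  refine (Submodule.eq_bot_iff _).2 fun x ⟨hA, hB⟩ => KHom.dsum_ext true ?_ ?_
  · rw [key hM _ x hA hB, map_zero]
  · rw [key hN _ x hA hB, map_zero]

end StructureMaps

theorem KRep.linA_surjective_Inj (i : ℕ) : Function.Surjective (KRep.Inj k i).linA :=
  fun y => ⟨Fin.snoc (α := fun _ => k) y 0, funext fun r =>
    (KRep.Inj_A_mulVec i _ r).trans (Fin.snoc_castSucc (α := fun _ => k) _ _ r)⟩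

theorem KRep.ker_linA_inf_ker_linB_Inj {i : ℕ} (hi : 1 ≤ i) :
    LinearMap.ker (KRep.Inj k i).linA ⊓ LinearMap.ker (KRep.Inj k i).linB = ⊥ := by
  refine (Submodule.eq_bot_iff _).2 fun x ⟨hA, hB⟩ => funext fun r => ?_
  rcases Nat.eq_zero_or_pos (r : ℕ) with h | h
  · refine (congrArg x (Fin.ext h)).trans ((KRep.Inj_A_mulVec i x ⟨0, hi⟩).symm.trans ?_)
    exact congrFun hA _
  · have hr : (r : ℕ) < i + 1 := r.2
    refine (congrArg x (Fin.ext (Nat.sub_add_cancel h).symm)).trans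
      ((KRep.Inj_B_mulVec i x ⟨(r : ℕ) - 1, by omega⟩).symm.trans ?_)
    exact congrFun hB _

theorem KRep.linA_surjective_injSum (l : List ℕ) :
    Function.Surjective (KRep.injSum k l).linA := by
  induction l with
  | nil => exact fun y => ⟨0, Subsingleton.elim (α := Fin 0 → k) _ _⟩
  | cons i l ih => exact KRep.linA_surjective_dsum (KRep.linA_surjective_Inj i) ih

theorem KRep.ker_linA_inf_ker_linB_injSum {l : List ℕ} (hl : ∀ i ∈ l, 1 ≤ i) :
    LinearMap.ker (KRep.injSum k l).linA ⊓ LinearMap.ker (KRep.injSum k l).linB = ⊥ := by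
  induction l with
  | nil => exact (Submodule.eq_bot_iff _).2 fun x _ => Subsingleton.elim (α := Fin 0 → k) _ _
  | cons i l ih =>
    exact KRep.ker_linA_inf_ker_linB_dsum (KRep.ker_linA_inf_ker_linB_Inj (hl i (by simp)))
      (ih fun i h => hl i (by simp [h]))

/-! ### Extensions with trivial dimension at one vertex -/

theorem KRep.dim_dsumList_replicate (b : Bool) (m : ℕ) (M : KRep k) :
    (KRep.dsumList (List.replicate m M)).dim b = m * M.dim b := by
  induction m with
  | zero => cases b <;> simp [KRep.dsumList, KRep.zero, KRep.dim]
  | succ m ih =>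
    rw [List.replicate_succ]
    refine (KRep.dim_dsum M _ b).trans ?_
    rw [show KRep.dim (List.foldr KRep.dsum KRep.zero (List.replicate m M)) b = _ from ih]
    ring

theorem exists_ses_of_bijective_true {M L : KRep k} (g : KHom M L)
    (h1 : Function.Surjective (g.lin false)) (h2 : Function.Bijective (g.lin true)) :
    ∃ m, SES (KRep.dsumList (List.replicate m (KRep.P k 0))) M L := by
  set m := Module.finrank k (LinearMap.ker (g.lin false)) with hm
  set N : KRep k := KRep.dsumList (List.replicate m (KRep.P k 0))
  have hd1 : N.dim false = m := by
    rw [KRep.dim_dsumList_replicate]; exact mul_one m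
  have hd2 : N.dim true = 0 := by
    rw [KRep.dim_dsumList_replicate]; exact mul_zero m
  have : Subsingleton (Fin (N.dim true) → k) := by rw [hd2]; infer_instance
  let e : (Fin (N.dim false) → k) ≃ₗ[k] LinearMap.ker (g.lin false) :=
    LinearEquiv.ofFinrankEq _ _ (by simp [hd1, hm])
  let F : (Fin (N.dim false) → k) →ₗ[k] (Fin (M.dim false) → k) :=
    (LinearMap.ker (g.lin false)).subtype ∘ₗ e
  let f : KHom N M := KHom.ofLin F 0
    (fun x => by
      have hx : x = 0 := this.elim x 0
      rw [hx, Matrix.mulVec_zero]; exact (map_zero F).trans (Matrix.mulVec_zero M.A).symm)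
    (fun x => by
      have hx : x = 0 := this.elim x 0
      rw [hx, Matrix.mulVec_zero]; exact (map_zero F).trans (Matrix.mulVec_zero M.B).symm)
  have hf1 : f.lin false = F := KHom.ofLin_lin_false _ _ _ _
  refine ⟨m, f, g, ⟨?_, ?_⟩, ⟨h1, h2.2⟩, ?_, ?_⟩
  · change Function.Injective (f.lin false)
    rw [hf1]
    exact Subtype.val_injective.comp e.injective
  · exact fun x y _ => this.elim x y
  · change LinearMap.range (f.lin false) = LinearMap.ker (g.lin false)
    rw [hf1, LinearMap.range_comp, LinearEquiv.range, Submodule.map_top, Submodule.range_subtype]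
  · change LinearMap.range (f.lin true) = LinearMap.ker (g.lin true)
    rw [LinearMap.ker_eq_bot.2 h2.1, LinearMap.range_eq_bot]
    exact LinearMap.ext fun x => (congrArg _ (this.elim x 0)).trans (map_zero _)

theorem exists_ses_of_bijective_false {M L : KRep k} (f : KHom M L)
    (h1 : Function.Bijective (f.lin false)) (h2 : Function.Injective (f.lin true)) :
    ∃ m, SES M L (KRep.dsumList (List.replicate m (KRep.Inj k 0))) := by
  set m := Module.finrank k ((Fin (L.dim true) → k) ⧸ LinearMap.range (f.lin true)) with hm
  set N : KRep k := KRep.dsumList (List.replicate m (KRep.Inj k 0))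
  have hd1 : N.dim false = 0 := by
    rw [KRep.dim_dsumList_replicate]; exact mul_zero m
  have hd2 : N.dim true = m := by
    rw [KRep.dim_dsumList_replicate]; exact mul_one m
  have : Subsingleton (Fin (N.dim false) → k) := by rw [hd1]; infer_instance
  let e : ((Fin (L.dim true) → k) ⧸ LinearMap.range (f.lin true)) ≃ₗ[k] (Fin (N.dim true) → k) :=
    LinearEquiv.ofFinrankEq _ _ (by simp [hd2, hm])
  let G : (Fin (L.dim true) → k) →ₗ[k] (Fin (N.dim true) → k) :=
    e ∘ₗ (LinearMap.range (f.lin true)).mkQ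
  let g : KHom L N := KHom.ofLin 0 G (fun x => this.elim _ _) (fun x => this.elim _ _)
  have hg2 : g.lin true = G := KHom.ofLin_lin_true _ _ _ _
  refine ⟨m, f, g, ⟨h1.1, h2⟩, ⟨?_, ?_⟩, ?_, ?_⟩
  · exact fun y => ⟨0, this.elim _ _⟩
  · change Function.Surjective (g.lin true)
    rw [hg2]
    exact e.surjective.comp (Submodule.mkQ_surjective _)
  · change LinearMap.range (f.lin false) = LinearMap.ker (g.lin false)
    rw [LinearMap.range_eq_top.2 h1.2, eq_comm, LinearMap.ker_eq_top]
    exact LinearMap.ext fun x => this.elim _ _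
  · change LinearMap.range (f.lin true) = LinearMap.ker (g.lin true)
    rw [hg2, LinearEquiv.ker_comp, Submodule.ker_mkQ]

/-- There is a monomorphism `M → N` that is bijective at the sink. -/
def Fills (M N : KRep k) : Prop :=
  ∃ f : KHom M N, Function.Bijective (f.lin false) ∧ Function.Injective (f.lin true)

theorem Fills.dsum_Inj_zero {M N : KRep k} (h : Fills M N) : Fills M ((KRep.Inj k 0).dsum N) := by
  obtain ⟨f, h1, h2⟩ := h
  have hinj : ∀ b, Function.Injective (f.lin b) →
      Function.Injective (((KHom.zero M (KRep.Inj k 0)).lift f).lin b) := fun b hb x y hxy =>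
    hb (by simpa using congrArg ((KHom.snd _ _).lin b) hxy)
  refine ⟨(KHom.zero M (KRep.Inj k 0)).lift f, ⟨hinj _ h1.1, fun y => ?_⟩, hinj _ h2⟩
  obtain ⟨x, hx⟩ := h1.2 ((KHom.snd _ _).lin false y)
  exact ⟨x, KHom.dsum_ext false (Subsingleton.elim (α := Fin 0 → k) _ _) (by simp [hx])⟩

theorem Fills.dsum {M N : KRep k} (h : Fills M N) (T : KRep k) :
    Fills (T.dsum M) (T.dsum N) := by
  obtain ⟨f, h1, h2⟩ := h
  let F : KHom (T.dsum M) (T.dsum N) := (KHom.fst T M).lift (f.comp (KHom.snd T M))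
  have hinj : ∀ b, Function.Injective (f.lin b) → Function.Injective (F.lin b) := by
    intro b hb x y hxy
    refine KHom.dsum_ext b ?_ (hb ?_)
    · simpa [F] using congrArg ((KHom.fst _ _).lin b) hxy
    · simpa [F, KHom.comp_lin] using congrArg ((KHom.snd _ _).lin b) hxy
  refine ⟨F, ⟨hinj _ h1.1, fun y => ?_⟩, hinj _ h2⟩
  obtain ⟨x, hx⟩ := h1.2 ((KHom.snd _ _).lin false y)
  refine ⟨(KHom.inl T M).lin false ((KHom.fst T N).lin false y) + (KHom.inr T M).lin false x,
    KHom.dsum_ext false ?_ ?_⟩ <;> simp [F, KHom.comp_lin, hx]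

theorem Fills.replicate_zero_append {p q : ℕ} (hpq : p ≤ q) {a u : List ℕ}
    (h : Fills (KRep.injSum k a) (KRep.injSum k u)) :
    Fills (KRep.injSum k (List.replicate p 0 ++ a)) (KRep.injSum k (List.replicate q 0 ++ u)) := by
  induction q generalizing p with
  | zero =>
    obtain rfl : p = 0 := by omega
    exact h
  | succ q ih =>
    cases p with
    | zero => exact (ih (Nat.zero_le q)).dsum_Inj_zero
    | succ p => exact (ih (Nat.succ_le_succ_iff.1 hpq)).dsum _

theorem exists_ses_source {n : ℕ} {c u : ℕ → ℕ}
    (heq : ∑ i ∈ Finset.Icc 0 n, (i + 1) * u i = ∑ i ∈ Finset.Icc 0 n, (i + 1) * c i)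
    (hle : ∀ t, 1 ≤ t → t ≤ n →
      ∑ i ∈ Finset.Icc t n, (i + 1) * u i ≤ ∑ i ∈ Finset.Icc t n, (i + 1) * c i) :
    ∃ α, SES (KRep.dsumList (List.replicate α (KRep.P k 0))) (KRep.multi k c n)
      (KRep.multi k u n) := by
  rw [KRep.multi_eq_injSum, KRep.multi_eq_injSum]
  obtain ⟨g, hg⟩ := exists_bijective_of_tail_le (k := k) true (p := 0) (n := n) (c := c) (u := u)
    (by simp) (by omega) (fun t _ => by
      rcases Nat.eq_zero_or_pos t with rfl | ht
      · exact heq.le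
      · rcases le_or_gt t n with htn | htn
        · exact hle t ht htn
        · simp [Finset.Icc_eq_empty_of_lt htn]) heq
  refine exists_ses_of_bijective_true g (fun y => ?_) hg
  obtain ⟨x, rfl⟩ := KRep.linA_surjective_injSum _ y
  obtain ⟨z, rfl⟩ := hg.2 x
  exact ⟨_, g.lin_linA z⟩

theorem exists_ses_sink {n : ℕ} {a u : ℕ → ℕ} (h0 : a 0 ≤ u 0)
    (hle : ∀ t, 2 ≤ t → t ≤ n → ∑ i ∈ Finset.Icc t n, i * u i ≤ ∑ i ∈ Finset.Icc t n, i * a i)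
    (heq : ∑ i ∈ Finset.Icc 1 n, i * u i = ∑ i ∈ Finset.Icc 1 n, i * a i) :
    ∃ β, SES (KRep.multi k a n) (KRep.multi k u n)
      (KRep.dsumList (List.replicate β (KRep.Inj k 0))) := by
  rw [KRep.multi_eq_injSum, KRep.multi_eq_injSum, indexList_succ, indexList_succ]
  obtain ⟨f, hf⟩ := exists_bijective_of_tail_le (k := k) false (p := 1) (n := n) (c := a) (u := u)
    (by simp) (by omega) (fun t ht => by
      rcases ht.eq_or_lt with rfl | ht
      · exact heq.le
      · rcases le_or_gt t n with htn | htn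
        · exact hle t ht htn
        · simp [Finset.Icc_eq_empty_of_lt htn]) heq
  have hbot := KRep.ker_linA_inf_ker_linB_injSum (k := k) (l := indexList a 1 n)
    fun _ => le_of_mem_indexList
  have hinj : Function.Injective (f.lin true) :=
    (injective_iff_map_eq_zero _).2 fun x hx => (Submodule.eq_bot_iff _).1 hbot x
      ⟨hf.1 ((f.lin_linA x).trans (by rw [hx, map_zero, map_zero])),
        hf.1 ((f.lin_linB x).trans (by rw [hx, map_zero, map_zero]))⟩
  obtain ⟨g, hg1, hg2⟩ := Fills.replicate_zero_append h0 ⟨f, hf, hinj⟩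
  exact exists_ses_of_bijective_false g hg1 hg2

/-! ### Chains of functionals on a representation -/

/-- Pairs of functionals `(φ, φ')` at the sink with `φ ∘ B = φ' ∘ A`. -/
def KRep.sinkRel (M : KRep k) :
    Submodule k (Module.Dual k (Fin (M.dim false) → k) × Module.Dual k (Fin (M.dim false) → k)) :=
  relDom M.linA.dualMap M.linB.dualMap

/-- Pairs of functionals `(φ ∘ A, φ ∘ B)` at the source. -/
def KRep.sourceRel (M : KRep k) :
    Submodule k (Module.Dual k (Fin (M.dim true) → k) × Module.Dual k (Fin (M.dim true) → k)) :=
  relCod M.linA.dualMap M.linB.dualMap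

section Functionals

variable {M N : KRep k}

theorem KHom.dualMap_linA (f : KHom M N) (φ : Module.Dual k (Fin (N.dim false) → k)) :
    M.linA.dualMap ((f.lin false).dualMap φ) = (f.lin true).dualMap (N.linA.dualMap φ) :=
  LinearMap.ext fun x => congrArg φ (f.lin_linA x)

theorem KHom.dualMap_linB (f : KHom M N) (φ : Module.Dual k (Fin (N.dim false) → k)) :
    M.linB.dualMap ((f.lin false).dualMap φ) = (f.lin true).dualMap (N.linB.dualMap φ) :=
  LinearMap.ext fun x => congrArg φ (f.lin_linB x)

theorem KHom.dualMap_mem_chains_sinkRel (f : KHom M N) {t : ℕ}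
    {z : Fin t → Module.Dual k (Fin (N.dim false) → k)} (hz : z ∈ chains N.sinkRel t) :
    (fun i => (f.lin false).dualMap (z i)) ∈ chains M.sinkRel t := by
  intro i h
  refine mem_relDom.2 ?_
  have := mem_relDom.1 (hz i h)
  dsimp only at this ⊢
  rw [f.dualMap_linA, f.dualMap_linB, this]

theorem KHom.dualMap_mem_chains_sourceRel (f : KHom M N) {t : ℕ}
    {z : Fin t → Module.Dual k (Fin (N.dim true) → k)} (hz : z ∈ chains N.sourceRel t) :
    (fun i => (f.lin true).dualMap (z i)) ∈ chains M.sourceRel t := by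
  intro i h
  obtain ⟨x, h1, h2⟩ := mem_relCod.1 (hz i h)
  refine mem_relCod.2 ⟨(f.lin false).dualMap x, ?_, ?_⟩
  · rw [f.dualMap_linA, h1]
  · rw [f.dualMap_linB, h2]

/-- The functionals that occur in chains of length `t` at the sink, and their composites with the
structure maps, span subspaces of dimension at most `d` and `e`. -/
def KRep.ChainBound (M : KRep k) (t d e : ℕ) : Prop :=
  ∃ (F : Submodule k (Module.Dual k (Fin (M.dim false) → k)))
    (E : Submodule k (Module.Dual k (Fin (M.dim true) → k))),
    Module.finrank k F ≤ d ∧ Module.finrank k E ≤ e ∧ ∀ z ∈ chains M.sinkRel t, ∀ i,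
      z i ∈ F ∧ M.linA.dualMap (z i) ∈ E ∧ M.linB.dualMap (z i) ∈ E

theorem finrank_comap_inf_comap_le {V W W' : Type*} [AddCommGroup V] [Module k V]
    [AddCommGroup W] [Module k W] [FiniteDimensional k W] [AddCommGroup W'] [Module k W']
    [FiniteDimensional k W'] (p : V →ₗ[k] W) (q : V →ₗ[k] W')
    (h : Function.Injective (p.prod q)) (F : Submodule k W) (F' : Submodule k W') :
    Module.finrank k ↥(F.comap p ⊓ F'.comap q) ≤ Module.finrank k F + Module.finrank k F' := by
  rw [← Module.finrank_prod]
  let P := F.comap p ⊓ F'.comap q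
  let T : P →ₗ[k] F × F' := LinearMap.prod ((p ∘ₗ P.subtype).codRestrict F fun x => x.2.1)
    ((q ∘ₗ P.subtype).codRestrict F' fun x => x.2.2)
  refine LinearMap.finrank_le_finrank_of_injective (f := T) fun x y hxy => ?_
  exact Subtype.ext (h (Prod.ext (congrArg (fun w => (w.1 : W)) hxy)
    (congrArg (fun w => (w.2 : W')) hxy)))

theorem finrank_comap_inl_inf_comap_inr_le (b : Bool)
    (F : Submodule k (Module.Dual k (Fin (M.dim b) → k)))
    (F' : Submodule k (Module.Dual k (Fin (N.dim b) → k))) :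
    Module.finrank k ↥(F.comap ((KHom.inl M N).lin b).dualMap ⊓
      F'.comap ((KHom.inr M N).lin b).dualMap) ≤ Module.finrank k F + Module.finrank k F' := by
  refine finrank_comap_inf_comap_le _ _ (fun φ ψ h => LinearMap.ext fun x => ?_) F F'
  rw [← KHom.inl_add_inr b x, map_add, map_add]
  exact congrArg₂ _ (LinearMap.congr_fun (congrArg Prod.fst h) _)
    (LinearMap.congr_fun (congrArg Prod.snd h) _)

theorem KRep.ChainBound.dsum {t d e d' e' : ℕ} (hM : M.ChainBound t d e)
    (hN : N.ChainBound t d' e') : (M.dsum N).ChainBound t (d + d') (e + e') := by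
  obtain ⟨F, E, hF, hE, h⟩ := hM
  obtain ⟨F', E', hF', hE', h'⟩ := hN
  refine ⟨_, _, (finrank_comap_inl_inf_comap_inr_le false F F').trans (Nat.add_le_add hF hF'),
    (finrank_comap_inl_inf_comap_inr_le true E E').trans (Nat.add_le_add hE hE'),
    fun z hz i => ?_⟩
  obtain ⟨h1, h2, h3⟩ := h _ ((KHom.inl M N).dualMap_mem_chains_sinkRel hz) i
  obtain ⟨h1', h2', h3'⟩ := h' _ ((KHom.inr M N).dualMap_mem_chains_sinkRel hz) i
  rw [KHom.dualMap_linA] at h2 h2'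
  rw [KHom.dualMap_linB] at h3 h3'
  exact ⟨⟨h1, h1'⟩, ⟨h2, h2'⟩, ⟨h3, h3'⟩⟩

end Functionals

/-- The coordinate vector at `j`, which is zero for `d ≤ j`. -/
def coordVec (k : Type) [Field k] (d j : ℕ) : Fin d → k := fun r => if (r : ℕ) = j then 1 else 0

theorem KRep.linA_coordVec (i j : ℕ) :
    (KRep.Inj k i).linA (coordVec k _ j) = coordVec k _ j :=
  funext fun r => KRep.Inj_A_mulVec i (coordVec k _ j) r

theorem KRep.linB_coordVec_succ (i j : ℕ) :
    (KRep.Inj k i).linB (coordVec k _ (j + 1)) = coordVec k _ j :=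
  funext fun r => (KRep.Inj_B_mulVec i (coordVec k _ (j + 1)) r).trans
    (if_congr Nat.succ_inj rfl rfl)

theorem KRep.linB_coordVec_zero (i : ℕ) : (KRep.Inj k i).linB (coordVec k _ 0) = 0 :=
  funext fun r => (KRep.Inj_B_mulVec i (coordVec k _ 0) r).trans (if_neg (Nat.succ_ne_zero r))

theorem KRep.chains_sinkRel_Inj {i t : ℕ} (hit : i < t)
    {z : Fin t → Module.Dual k (Fin ((KRep.Inj k i).dim false) → k)}
    (hz : z ∈ chains (KRep.Inj k i).sinkRel t) (m : Fin t) : z m = 0 := by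
  have hrel : ∀ m (h : m + 1 < t) x, z ⟨m, by omega⟩ ((KRep.Inj k i).linB x) =
      z ⟨m + 1, h⟩ ((KRep.Inj k i).linA x) := fun m h x =>
    LinearMap.congr_fun (mem_relDom.1 (hz m h)) x
  have hdiag : ∀ s m j (h : m + s < t), z ⟨m, by omega⟩ (coordVec k _ j) =
      z ⟨m + s, h⟩ (coordVec k _ (j + s)) := by
    intro s
    induction s with
    | zero => exact fun _ _ _ => rfl
    | succ s ih =>
      intro m j h
      rw [ih m j (by omega), ← KRep.linB_coordVec_succ, hrel _ (by omega), KRep.linA_coordVec]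
      rfl
  have hleft : ∀ m (h : m + 1 < t), z ⟨m + 1, h⟩ (coordVec k _ 0) = 0 := by
    intro m h
    rw [← KRep.linA_coordVec, ← hrel, KRep.linB_coordVec_zero, map_zero]
  have hright : ∀ m (h : m < t), z ⟨m, h⟩ (coordVec k _ i) = 0 := by
    intro m h
    have : coordVec k ((KRep.Inj k i).dim false) i = 0 := funext fun r => if_neg r.2.ne
    rw [this, map_zero]
  have hall : ∀ j, j < i → z m (coordVec k _ j) = 0 := by
    intro j hj
    rcases le_or_gt (m : ℕ) j with h | h
    · have := hdiag (i - j) m j (by omega)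
      rw [this]
      have e : j + (i - j) = i := by omega
      rw [e]
      exact hright _ _
    · obtain ⟨q, hq⟩ : ∃ q, (m : ℕ) = q + 1 + j := ⟨m - j - 1, by omega⟩
      have hm : m = ⟨q + 1 + j, by omega⟩ := Fin.ext hq
      have := hdiag j (q + 1) 0 (by omega)
      rw [zero_add] at this
      rw [hm, ← this]
      exact hleft _ _
  refine LinearMap.pi_ext fun r x => ?_
  have hx : (Pi.single r x : Fin ((KRep.Inj k i).dim false) → k) = x • coordVec k _ r := by
    ext q
    by_cases h : q = r <;> simp [coordVec, h, Fin.val_inj]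
  rw [hx, map_smul, hall r r.2, smul_zero, LinearMap.zero_apply]

theorem KRep.chainBound_Inj (i t : ℕ) :
    (KRep.Inj k i).ChainBound t (if t ≤ i then i else 0) (if t ≤ i then i + 1 else 0) := by
  by_cases h : t ≤ i
  · refine ⟨⊤, ⊤, ?_, ?_, fun _ _ _ => ⟨trivial, trivial, trivial⟩⟩
    · rw [if_pos h, finrank_top, Subspace.dual_finrank_eq, Module.finrank_fin_fun]; rfl
    · rw [if_pos h, finrank_top, Subspace.dual_finrank_eq, Module.finrank_fin_fun]; rfl
  · refine ⟨⊥, ⊥, by simp, by simp, fun z hz m => ?_⟩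
    rw [KRep.chains_sinkRel_Inj (not_le.1 h) hz m, map_zero, map_zero]
    exact ⟨Submodule.zero_mem _, Submodule.zero_mem _, Submodule.zero_mem _⟩

theorem KRep.chainBound_injSum (l : List ℕ) (t : ℕ) :
    (KRep.injSum k l).ChainBound t (l.map fun i => if t ≤ i then i else 0).sum
      (l.map fun i => if t ≤ i then i + 1 else 0).sum := by
  induction l with
  | nil =>
    have h : ∀ b, Module.finrank k (Module.Dual k (Fin ((KRep.injSum k []).dim b) → k)) = 0 := by
      intro b
      rw [Subspace.dual_finrank_eq, Module.finrank_fin_fun, KRep.dim_injSum_nil]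
    exact ⟨⊤, ⊤, by rw [finrank_top, h]; simp, by rw [finrank_top, h]; simp,
      fun _ _ _ => ⟨trivial, trivial, trivial⟩⟩
  | cons i l ih =>
    rw [KRep.injSum_cons, List.map_cons, List.map_cons, List.sum_cons, List.sum_cons]
    exact (KRep.chainBound_Inj i t).dsum ih

theorem sum_Ico_ite_le_mul (n t : ℕ) (w a : ℕ → ℕ) :
    ∑ i ∈ Finset.Ico 0 (0 + (n + 1)), (if t ≤ i then w i else 0) * a i =
      ∑ i ∈ Finset.Icc t n, w i * a i := by
  simp only [ite_mul, zero_mul]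
  rw [← Finset.sum_filter]
  congr 1
  ext i
  simp only [Finset.mem_filter, Finset.mem_Ico, Finset.mem_Icc]
  omega

theorem KRep.chainBound_multi (a : ℕ → ℕ) (n t : ℕ) :
    (KRep.multi k a n).ChainBound t (∑ i ∈ Finset.Icc t n, i * a i)
      (∑ i ∈ Finset.Icc t n, (i + 1) * a i) := by
  have := KRep.chainBound_injSum (k := k) (indexList a 0 (n + 1)) t
  rwa [sum_map_indexList, sum_map_indexList, sum_Ico_ite_le_mul, sum_Ico_ite_le_mul n t (· + 1),
    ← KRep.multi_eq_injSum] at this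

theorem KRep.dim_multi (b : Bool) (a : ℕ → ℕ) (n : ℕ) :
    (KRep.multi k a n).dim b = ∑ i ∈ Finset.Icc 0 n, (i + b.toNat) * a i := by
  rw [KRep.multi_eq_injSum, KRep.dim_injSum, sum_map_indexList,
    ← sum_Ico_ite_le_mul n 0 (· + b.toNat)]
  simp

/-! ### Multiplicities from ranks of chains -/

theorem sum_second_difference {G u : ℕ → ℕ} {n : ℕ}
    (hu : ∀ t, u t + 2 * G (t + 1) = G t + G (t + 2))
    (hG : ∀ t, n < t → G t = 0) (e t : ℕ) :
    ∑ i ∈ Finset.Icc t n, (i + e) * u i + (t + e) * G (t + 1) = (t + e) * G t + G (t + 1) := by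
  obtain ⟨d, hd⟩ : ∃ d, n < t + d := ⟨n + 1, by omega⟩
  induction d generalizing t with
  | zero =>
    rw [add_zero] at hd
    rw [Finset.Icc_eq_empty_of_lt hd, hG t hd, hG (t + 1) (by omega)]
    simp
  | succ d ih =>
    rcases lt_or_ge n t with h | h
    · rw [Finset.Icc_eq_empty_of_lt h, hG t h, hG (t + 1) (by omega)]
      simp
    have h1 := ih (t + 1) (by omega)
    have h2 := hu t
    rw [← Finset.insert_Icc_add_one_left_eq_Icc h, Finset.sum_insert (by simp)]
    zify at h1 h2 ⊢
    linear_combination (t + e : ℤ) * h2 + h1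

section Ranks

variable {L M : KRep k}

/-- The dimension of the space of chains of length `t + 1` at the source. -/
noncomputable def KRep.chainRank (L : KRep k) (t : ℕ) : ℕ :=
  Module.finrank k (chains L.sourceRel (t + 1))

theorem finrank_chains_one {Z : Type*} [AddCommGroup Z] [Module k Z] (R : Submodule k (Z × Z)) :
    Module.finrank k (chains R 1) = Module.finrank k Z := by
  have h : chains R 1 = ⊤ := eq_top_iff.2 fun z _ i hi => absurd hi (by omega)
  rw [h, finrank_top]
  exact (LinearEquiv.funUnique (Fin 1) k Z).finrank_eq

theorem finrank_chains_eq_zero {Z : Type*} [AddCommGroup Z] [Module k Z]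
    [FiniteDimensional k Z] {R : Submodule k (Z × Z)} {t : ℕ} {F : Submodule k Z}
    (hF : Module.finrank k F = 0) (h : ∀ z ∈ chains R t, ∀ i, z i ∈ F) :
    Module.finrank k (chains R t) = 0 := by
  rw [Submodule.finrank_eq_zero] at hF ⊢
  rw [hF] at h
  exact (Submodule.eq_bot_iff _).2 fun z hz => funext fun i => (Submodule.mem_bot k).1 (h z hz i)

theorem finrank_comap_le_of_injective {Z W : Type*} [AddCommGroup Z] [Module k Z]
    [AddCommGroup W] [Module k W] [FiniteDimensional k W] {p : Z →ₗ[k] W}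
    (hp : Function.Injective p) (F : Submodule k W) :
    Module.finrank k ↥(F.comap p) ≤ Module.finrank k F :=
  LinearMap.finrank_le_finrank_of_injective
    (f := (p ∘ₗ (F.comap p).subtype).codRestrict F fun x => x.2)
    fun _ _ h => Subtype.ext (hp (congrArg Subtype.val h))

theorem finrank_comap_add_le {Z W : Type*} [AddCommGroup Z] [Module k Z] [FiniteDimensional k Z]
    [AddCommGroup W] [Module k W] [FiniteDimensional k W] {p : Z →ₗ[k] W}
    (hp : Function.Surjective p) (F : Submodule k W) :
    Module.finrank k ↥(F.comap p) + Module.finrank k W ≤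
      Module.finrank k F + Module.finrank k Z := by
  have h1 := LinearMap.finrank_range_add_finrank_ker p
  rw [LinearMap.range_eq_top.2 hp, finrank_top] at h1
  have h2 := finrank_le_finrank_range_add (p ∘ₗ (F.comap p).subtype) (F.comap p).subtype
    (LinearMap.ker p) (fun v h => h) (fun v _ h => Subtype.ext h)
  have h3 : LinearMap.range (p ∘ₗ (F.comap p).subtype) ≤ F := by
    rintro _ ⟨x, rfl⟩
    exact x.2
  have h4 := Submodule.finrank_mono h3
  omega

theorem KRep.ChainBound.exists_source {t d e : ℕ} (h : M.ChainBound t d e) (ht : 0 < t) :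
    ∃ E : Submodule k (Module.Dual k (Fin (M.dim true) → k)), Module.finrank k E ≤ e ∧
      ∀ z ∈ chains M.sourceRel (t + 1), ∀ i, z i ∈ E := by
  obtain ⟨_, E, _, hE, h⟩ := h
  refine ⟨E, hE, fun z hz i => ?_⟩
  obtain ⟨x, hx, hxz⟩ := exists_chain_relDom hz
  refine Fin.lastCases ?_ (fun i => ?_) i
  · obtain ⟨s, rfl⟩ : ∃ s, t = s + 1 := ⟨t - 1, by omega⟩
    rw [← Fin.succ_last, ← (hxz (Fin.last s)).2]
    exact (h x hx _).2.2
  · rw [← (hxz i).1]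
    exact (h x hx i).2.1

theorem KRep.chainRank_zero (L : KRep k) : L.chainRank 0 = L.dim true :=
  (finrank_chains_one _).trans (Subspace.dual_finrank_eq.trans (Module.finrank_fin_fun k))

theorem KRep.chainRank_succ (hL : Function.Surjective L.linA) (t : ℕ) :
    L.chainRank (t + 1) = Module.finrank k (chains L.sinkRel (t + 1)) :=
  finrank_chains_relCod _ _ (fun _ hx _ => LinearMap.dualMap_injective_of_surjective hL
    (hx.trans (map_zero _).symm)) t

theorem KRep.chainRank_one (hL : Function.Surjective L.linA) : L.chainRank 1 = L.dim false :=
  (KRep.chainRank_succ hL 0).trans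
    ((finrank_chains_one _).trans (Subspace.dual_finrank_eq.trans (Module.finrank_fin_fun k)))

theorem KRep.two_mul_chainRank_le (L : KRep k) (t : ℕ) :
    2 * L.chainRank (t + 1) ≤ L.chainRank t + L.chainRank (t + 2) :=
  two_mul_finrank_chains_le L.sourceRel t

theorem KRep.chainRank_eq_zero {t d : ℕ} (g : KHom M L) (hg : Function.Surjective (g.lin true))
    (ht : 0 < t) (hM : M.ChainBound t d 0) : L.chainRank t = 0 := by
  obtain ⟨E, hE, h⟩ := hM.exists_source ht
  refine finrank_chains_eq_zero (F := E.comap (g.lin true).dualMap)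
    (Nat.le_zero.1 ((finrank_comap_le_of_injective
      (LinearMap.dualMap_injective_of_surjective hg) E).trans hE)) fun z hz i => ?_
  exact h _ (g.dualMap_mem_chains_sourceRel hz) i

theorem KRep.mul_chainRank_le_of_epi {t d e : ℕ} (g : KHom M L)
    (hg : Function.Surjective (g.lin true)) (ht : 0 < t) (hM : M.ChainBound t d e) :
    (t + 1) * L.chainRank t ≤ e + t * L.chainRank (t + 1) := by
  obtain ⟨E, hE, h⟩ := hM.exists_source ht
  refine (mul_finrank_chains_le L.sourceRel (E.comap (g.lin true).dualMap) t fun z hz i =>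
    h _ (g.dualMap_mem_chains_sourceRel hz) i).trans (Nat.add_le_add_right ?_ _)
  exact (finrank_comap_le_of_injective (LinearMap.dualMap_injective_of_surjective hg) E).trans hE

theorem KRep.mul_chainRank_le_of_sink {t d e : ℕ} (hL : Function.Surjective L.linA)
    (f : KHom M L) (hf : Function.Surjective (f.lin false)) (hM : M.ChainBound (t + 1) d e) :
    (t + 1) * L.chainRank (t + 1) ≤ d + t * L.chainRank (t + 2) := by
  obtain ⟨F, _, hF, _, h⟩ := hM
  rw [KRep.chainRank_succ hL, KRep.chainRank_succ hL]
  refine (mul_finrank_chains_le L.sinkRel (F.comap (f.lin false).dualMap) t fun z hz i =>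
    (h _ (f.dualMap_mem_chains_sinkRel hz) i).1).trans (Nat.add_le_add_right ?_ _)
  exact (finrank_comap_le_of_injective (LinearMap.dualMap_injective_of_surjective hf) F).trans hF

theorem KRep.two_mul_chainRank_one_add_le {d e : ℕ} (f : KHom M L)
    (hf : Function.Injective (f.lin true)) (hM : M.ChainBound 1 d e) :
    2 * L.chainRank 1 + M.dim true ≤ e + L.dim true + L.chainRank 2 := by
  obtain ⟨E, hE, h⟩ := hM.exists_source one_pos
  have h1 := mul_finrank_chains_le L.sourceRel (E.comap (f.lin true).dualMap) 1 fun z hz i =>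
    h _ (f.dualMap_mem_chains_sourceRel hz) i
  have h2 := finrank_comap_add_le (LinearMap.dualMap_surjective_of_injective hf) E
  rw [Subspace.dual_finrank_eq, Subspace.dual_finrank_eq, Module.finrank_fin_fun,
    Module.finrank_fin_fun] at h2
  simp only [one_mul, Nat.reduceAdd] at h1
  simp only [KRep.chainRank, Nat.reduceAdd]
  omega

end Ranks

theorem KHom.dim_eq_of_bijective {M L : KRep k} (f : KHom M L) {b : Bool}
    (hf : Function.Bijective (f.lin b)) : M.dim b = L.dim b := by
  simpa using (LinearEquiv.ofBijective _ hf).finrank_eq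

theorem SES.exists_bijective_true {M L : KRep k} {m : ℕ}
    (h : SES (KRep.dsumList (List.replicate m (KRep.P k 0))) M L) :
    ∃ g : KHom M L, Function.Surjective (g.lin false) ∧ Function.Bijective (g.lin true) := by
  obtain ⟨f, g, -, hg, -, hex⟩ := h
  refine ⟨g, hg.1, LinearMap.ker_eq_bot.1 (hex.symm.trans (LinearMap.range_eq_bot.2 ?_)), hg.2⟩
  have hd : (KRep.dsumList (List.replicate m (KRep.P k 0))).dim true = 0 := by
    rw [KRep.dim_dsumList_replicate]; exact mul_zero m
  have : IsEmpty (Fin ((KRep.dsumList (List.replicate m (KRep.P k 0))).dim true)) := by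
    rw [hd]; infer_instance
  exact LinearMap.ext fun x => (congrArg (f.lin true)
    (Subsingleton.elim (α := Fin (KRep.dim _ true) → k) x 0)).trans (map_zero _)

theorem SES.exists_bijective_false {M L : KRep k} {m : ℕ}
    (h : SES M L (KRep.dsumList (List.replicate m (KRep.Inj k 0)))) :
    ∃ f : KHom M L, Function.Bijective (f.lin false) ∧ Function.Injective (f.lin true) := by
  obtain ⟨f, g, hf, -, hex, -⟩ := h
  refine ⟨f, ⟨hf.1, LinearMap.range_eq_top.1 (hex.trans (LinearMap.ker_eq_top.2 ?_))⟩, hf.2⟩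
  have hd : (KRep.dsumList (List.replicate m (KRep.Inj k 0))).dim false = 0 := by
    rw [KRep.dim_dsumList_replicate]; exact mul_zero m
  have : IsEmpty (Fin ((KRep.dsumList (List.replicate m (KRep.Inj k 0))).dim false)) := by
    rw [hd]; infer_instance
  exact LinearMap.ext fun x => Subsingleton.elim (g.lin false x) 0

/-- `I′ = a₀I₀ ⊕ ⋯ ⊕ aₙIₙ` is a subfactor of `I = c₀I₀ ⊕ ⋯ ⊕ cₙIₙ`, i.e.
`[I] ∈ {[βI₀]} * {[I′]} * {[αP₀]}` for some `α, β` (equivalently there is a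
linking module `L` with `0 → I′ → L → βI₀ → 0` and `0 → αP₀ → I → L → 0`),
iff the linear system on the multiplicities `u₀, …, uₙ` of `L` has a
non-negative integer solution. -/
theorem preinjective_subfactor_system (n : ℕ) (a c : ℕ → ℕ) :
    (∃ (α β : ℕ) (L : KRep k),
      SES (KRep.multi k a n) L (KRep.dsumList (List.replicate β (KRep.Inj k 0))) ∧
      SES (KRep.dsumList (List.replicate α (KRep.P k 0))) (KRep.multi k c n) L) ↔
    (∃ u : ℕ → ℕ,
      a 0 ≤ u 0 ∧
      (∀ t, 2 ≤ t → t ≤ n →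
        (∑ i ∈ Finset.Icc t n, i * u i) ≤ ∑ i ∈ Finset.Icc t n, i * a i) ∧
      (∑ i ∈ Finset.Icc 1 n, i * u i) = (∑ i ∈ Finset.Icc 1 n, i * a i) ∧
      (∑ i ∈ Finset.Icc 0 n, (i + 1) * u i) = (∑ i ∈ Finset.Icc 0 n, (i + 1) * c i) ∧
      (∀ t, 1 ≤ t → t ≤ n →
        (∑ i ∈ Finset.Icc t n, (i + 1) * u i) ≤ ∑ i ∈ Finset.Icc t n, (i + 1) * c i)) := by
  constructor
  · rintro ⟨α, β, L, hβ, hα⟩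
    obtain ⟨f, hf1, hf2⟩ := hβ.exists_bijective_false
    obtain ⟨g, hg1, hg2⟩ := hα.exists_bijective_true
    have hL : Function.Surjective L.linA := by
      intro y
      obtain ⟨y, rfl⟩ := hg1 y
      have hA := KRep.linA_surjective_injSum (k := k) (indexList c 0 (n + 1))
      rw [← KRep.multi_eq_injSum] at hA
      obtain ⟨x, rfl⟩ := hA y
      exact ⟨_, (g.lin_linA x).symm⟩
    have h0 := KRep.chainRank_zero L
    have h1 := KRep.chainRank_one hL
    have hconv := KRep.two_mul_chainRank_le L
    have hzero : ∀ t, n < t → L.chainRank t = 0 := fun t ht => by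
      have h := KRep.chainBound_multi (k := k) c n t
      rw [Finset.Icc_eq_empty_of_lt ht, Finset.sum_empty, Finset.sum_empty] at h
      exact KRep.chainRank_eq_zero g hg2.2 (by omega) h
    have hdim1 := f.dim_eq_of_bijective hf1
    have hdim2 := g.dim_eq_of_bijective hg2
    have hsink := KRep.two_mul_chainRank_one_add_le f hf2 (KRep.chainBound_multi a n 1)
    rw [KRep.dim_multi, ← Finset.insert_Icc_add_one_left_eq_Icc (Nat.zero_le n),
      Finset.sum_insert (by simp)] at hdim1 hsink
    rw [KRep.dim_multi] at hdim2
    simp only [Bool.toNat_false, Bool.toNat_true, add_zero, zero_mul, zero_add, one_mul]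
      at hdim1 hdim2 hsink
    obtain ⟨u, hu⟩ : ∃ u : ℕ → ℕ, ∀ t,
        u t + 2 * L.chainRank (t + 1) = L.chainRank t + L.chainRank (t + 2) :=
      ⟨_, fun t => Nat.sub_add_cancel (hconv t)⟩
    have hsum := sum_second_difference hu hzero
    refine ⟨u, ?_, fun t ht _ => ?_, ?_, ?_, fun t ht _ => ?_⟩
    · have h2 := hu 0
      simp only [zero_add] at h2
      omega
    · obtain ⟨s, rfl⟩ : ∃ s, t = s + 1 := ⟨t - 1, by omega⟩
      have h2 := hsum 0 (s + 1)
      have h3 := KRep.mul_chainRank_le_of_sink hL f hf1.2 (KRep.chainBound_multi a n (s + 1))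
      simp only [add_zero] at h2
      nlinarith
    · have h2 := hsum 0 1
      simp only [add_zero, one_mul] at h2
      omega
    · have h2 := hsum 1 0
      simp only [zero_add, one_mul] at h2
      omega
    · have h2 := hsum 1 t
      have h3 := KRep.mul_chainRank_le_of_epi g hg2.2 ht (KRep.chainBound_multi c n t)
      nlinarith
  · rintro ⟨u, hu0, hu1, hu2, hu3, hu4⟩
    obtain ⟨β, hβ⟩ := exists_ses_sink (k := k) hu0 hu1 hu2
    obtain ⟨α, hα⟩ := exists_ses_source (k := k) hu3 hu4
    exact ⟨α, β, _, hβ, hα⟩
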